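/- arXiv:1903.08646 — 13 statements merged into one kernel-verified Lean document; each statement's English description precedes it below -/
import Mathlib

section
/- The sequence (p_n) converges and lim_{n→∞} p_n = 1/2. (Interpretation: in Bachet's game with lottery moves with n objects, parameters m and K, the probability that the first player wins in any subgame perfect Nash equilibrium converges to 1/2 as n → ∞.) -/
/-- A bound on one coordinate from a bound on a weighted average. -/
lemma aux_coord {m : ℕ} (w f : Fin m → ℝ) (hw : ∀ i, 0 ≤ w i) (hs : ∑ i, w i = 1)
    (c s δ : ℝ) (hδ : 0 < δ) (hf : ∀ i, f i ≤ c) (hge : c - s ≤ ∑ i, w i * f i)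
    (i : Fin m) (hi : δ ≤ w i) : c - s / δ ≤ f i := by
  have h1 : ∑ i, w i * (c - f i) ≤ s := by
    have : ∑ i, w i * (c - f i) = c - ∑ i, w i * f i := by
      simp only [mul_sub, Finset.sum_sub_distrib, ← Finset.sum_mul, hs, one_mul]
    linarith
  have h2 : w i * (c - f i) ≤ ∑ i, w i * (c - f i) :=
    Finset.single_le_sum (f := fun i => w i * (c - f i))
      (fun j _ => mul_nonneg (hw j) (by linarith [hf j])) (Finset.mem_univ i)
  have h3 : δ * (c - f i) ≤ w i * (c - f i) :=
    mul_le_mul_of_nonneg_right hi (by linarith [hf i])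
  have h4 : c - f i ≤ s / δ := by
    rw [le_div_iff₀ hδ]; linarith
  linarith

/-- Two distinct coordinates carry weight at least `(1-η)/m`. -/
lemma aux_two {m : ℕ} (hm : 1 < m) (w : Fin m → ℝ) (hs : ∑ i, w i = 1)
    (η : ℝ) (hη : ∀ i, w i ≤ η) (hη1 : η < 1) (hη0 : 0 ≤ η) :
    ∃ i j : Fin m, i < j ∧ (1 - η) / m ≤ w i ∧ (1 - η) / m ≤ w j := by
  have hm0 : (0 : ℝ) < m := by exact_mod_cast (by omega : 0 < m)
  have hd : 0 < (1 - η) / m := div_pos (by linarith) hm0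
  have hmd : (m : ℝ) * ((1 - η) / m) = 1 - η := by field_simp
  have h1 : ∃ i : Fin m, (1 - η) / m ≤ w i := by
    by_contra! h
    have : ∑ i, w i ≤ ∑ i : Fin m, (1 - η) / m := Finset.sum_le_sum fun i _ => (h i).le
    have h0 := h ⟨0, by omega⟩
    have hlt : ∑ i, w i < ∑ i : Fin m, (1 - η) / m :=
      Finset.sum_lt_sum (fun i _ => (h i).le) ⟨_, Finset.mem_univ _, h0⟩
    simp only [Finset.sum_const, Finset.card_univ, Fintype.card_fin, nsmul_eq_mul, hmd, hs] at hlt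
    linarith
  obtain ⟨i, hi⟩ := h1
  have h2 : ∃ j : Fin m, j ≠ i ∧ (1 - η) / m ≤ w j := by
    by_contra! h
    have e : w i + ∑ j ∈ Finset.univ.erase i, w j = 1 := by
      rw [Finset.add_sum_erase _ _ (Finset.mem_univ i), hs]
    have : ∑ j ∈ Finset.univ.erase i, w j ≤ ∑ j ∈ Finset.univ.erase i, (1 - η) / m :=
      Finset.sum_le_sum fun j hj => (h j (Finset.ne_of_mem_erase hj)).le
    rw [Finset.sum_const, Finset.card_erase_of_mem (Finset.mem_univ i), nsmul_eq_mul,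
      Finset.card_univ, Fintype.card_fin, Nat.cast_sub (by omega), Nat.cast_one, sub_mul, hmd] at this
    linarith [hη i]
  obtain ⟨j, hji, hj⟩ := h2
  rcases lt_or_gt_of_ne hji with h | h
  · exact ⟨j, i, h, hj, hi⟩
  · exact ⟨i, j, h, hi, hj⟩

theorem stmt_0
    (m : ℕ) (hm : 1 < m)
    (K : Set (Fin m → ℝ)) (hKne : K.Nonempty) (hKcpt : IsCompact K)
    (hKsub : ∀ π ∈ K, (∀ i, 0 ≤ π i) ∧ ∑ i, π i = 1)
    (p : ℤ → ℝ)
    (hp0 : ∀ s : ℤ, s ≤ 0 → p s = 1)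
    (hpk : ∀ k : ℤ, 1 ≤ k →
      IsGreatest {x : ℝ | ∃ π ∈ K, x = 1 - ∑ i : Fin m, π i * p (k - ((i : ℕ) + 1))} (p k))
    (η : ℝ) (hη : IsGreatest {x : ℝ | ∃ π ∈ K, ∃ i : Fin m, x = π i} η) (hη1 : η < 1)
    (ν : ℝ)
    (hν : IsLeast {x : ℝ | ∃ i : Fin m, IsGreatest {y : ℝ | ∃ π ∈ K, y = π i} x} ν)
    (hν0 : 0 < ν) :
    Filter.Tendsto (fun n : ℕ => p n) Filter.atTop (nhds (1/2)) := by
  have hm0 : (0 : ℝ) < m := by exact_mod_cast (by omega : 0 < m)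
  -- the centred sequence
  obtain ⟨q, hq⟩ : ∃ q : ℤ → ℝ, ∀ k, q k = p k - 1 / 2 := ⟨_, fun _ => rfl⟩
  have hsum : ∀ π ∈ K, ∀ k : ℤ, 1 - ∑ i : Fin m, π i * p (k - ((i : ℕ) + 1)) - 1 / 2
      = - ∑ i : Fin m, π i * q (k - ((i : ℕ) + 1)) := by
    intro π hπ k
    simp only [hq, mul_sub, Finset.sum_sub_distrib, ← Finset.sum_mul, (hKsub π hπ).2]
    ring
  have hatt : ∀ k : ℤ, 1 ≤ k → ∃ π ∈ K, q k = - ∑ i : Fin m, π i * q (k - ((i : ℕ) + 1)) := by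
    intro k hk
    obtain ⟨π, hπ, h⟩ := (hpk k hk).1
    exact ⟨π, hπ, by rw [← hsum π hπ, ← h, hq]⟩
  have hub : ∀ k : ℤ, 1 ≤ k → ∀ π ∈ K, - ∑ i : Fin m, π i * q (k - ((i : ℕ) + 1)) ≤ q k := by
    intro k hk π hπ
    have := (hpk k hk).2 ⟨π, hπ, rfl⟩
    rw [← hsum π hπ, hq]
    linarith
  have hνj : ∀ j : Fin m, ∃ π ∈ K, ν ≤ π j := by
    intro j
    obtain ⟨π, hπ, hmax⟩ := hKcpt.exists_isMaxOn hKne (continuous_apply j).continuousOn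
    refine ⟨π, hπ, hν.2 ⟨j, ⟨π, hπ, rfl⟩, ?_⟩⟩
    rintro y ⟨π', hπ', rfl⟩
    exact hmax hπ'
  have hη0 : 0 ≤ η := by
    obtain ⟨π, hπ, i, h⟩ := hη.1
    rw [h]; exact (hKsub π hπ).1 i
  have habs : ∀ π ∈ K, ∀ (c : ℝ) (f : Fin m → ℝ), (∀ i, f i ≤ c) → ∑ i, π i * f i ≤ c := by
    intro π hπ c f hf
    calc ∑ i, π i * f i ≤ ∑ i, π i * c :=
          Finset.sum_le_sum fun i _ => mul_le_mul_of_nonneg_left (hf i) ((hKsub π hπ).1 i)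
      _ = c := by rw [← Finset.sum_mul, (hKsub π hπ).2, one_mul]
  -- boundedness
  have hbdd : ∀ n : ℕ, ∀ s : ℤ, s ≤ n → |q s| ≤ 1 / 2 := by
    intro n
    induction n with
    | zero =>
      intro s hs
      rw [hq, hp0 s (by simpa using hs)]; norm_num
    | succ n ih =>
      intro s hs
      by_cases hsn : s ≤ n
      · exact ih s hsn
      have hs1 : 1 ≤ s := by omega
      obtain ⟨π, hπ, h⟩ := hatt s hs1
      have hb : ∀ i : Fin m, |q (s - ((i : ℕ) + 1))| ≤ 1 / 2 := fun i => ih _ (by push_cast at hs; omega)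
      have h1 := habs π hπ (1 / 2) _ (fun i => (abs_le.1 (hb i)).2)
      have h2 := habs π hπ (1 / 2) (fun i : Fin m => - q (s - ((i : ℕ) + 1)))
        (fun i => by linarith [(abs_le.1 (hb i)).1])
      simp only [mul_neg, Finset.sum_neg_distrib] at h2
      rw [abs_le]; constructor <;> linarith
  obtain ⟨δ, hδ⟩ : ∃ δ, δ = (1 - η) / m := ⟨_, rfl⟩
  have hδ0 : 0 < δ := by rw [hδ]; exact div_pos (by linarith) hm0
  obtain ⟨C, hC⟩ : ∃ C, C = 2 / δ + (1 + 2 / δ) / ν := ⟨_, rfl⟩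
  have hC0 : 0 < C := by rw [hC]; positivity
  -- key estimate
  have key : ∀ (A ε : ℝ) (k : ℤ), 0 < ε → (m : ℤ) + 1 ≤ k → (∀ j, k - 2 * m ≤ j → |q j| ≤ A + ε) →
      A - ε < q k → 2 * A ≤ C * ε := by
    intro A ε k hε hk hb hqk
    obtain ⟨π, hπ, h⟩ := hatt k (by omega)
    obtain ⟨i, j, hij, hi, hj⟩ := aux_two hm π (hKsub π hπ).2 η
      (fun i => hη.2 ⟨π, hπ, i, rfl⟩) hη1 hη0
    rw [← hδ] at hi hj
    have hlow : ∀ i : Fin m, δ ≤ π i → A + ε - 2 * ε / δ ≤ - q (k - ((i : ℕ) + 1)) := by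
      intro i hi
      refine aux_coord π (fun i : Fin m => - q (k - ((i : ℕ) + 1))) (hKsub π hπ).1 (hKsub π hπ).2
        (A + ε) (2 * ε) δ hδ0 (fun i => ?_) ?_ i hi
      · have := (abs_le.1 (hb (k - ((i : ℕ) + 1)) (by have := i.2; omega))).1
        linarith
      · simp only [mul_neg, Finset.sum_neg_distrib]
        linarith
    have hqi := hlow i hi
    have hqj := hlow j hj
    have hi2 := i.2
    have hj2 := j.2
    have hij' : (i : ℕ) < j := hij
    obtain ⟨l, hl⟩ : ∃ l : Fin m, (l : ℕ) + 1 + i = j := ⟨⟨j - i - 1, by omega⟩, by simp; omega⟩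
    obtain ⟨π', hπ', hνl⟩ := hνj l
    have hu := hub (k - ((i : ℕ) + 1)) (by omega) π' hπ'
    have hfin := aux_coord π' (fun l : Fin m => q (k - ((i : ℕ) + 1) - ((l : ℕ) + 1)))
      (hKsub π' hπ').1 (hKsub π' hπ').2 (A + ε) (2 * ε / δ) ν hν0
      (fun l => (abs_le.1 (hb _ (by have := l.2; omega))).2) (by linarith) l hνl
    have e : k - ((i : ℕ) + 1) - ((l : ℕ) + 1) = k - (((j : ℕ) : ℤ) + 1) := by omega
    simp only [e] at hfin
    have : C * ε = 2 * ε / δ + 2 * ε / δ / ν + ε / ν := by rw [hC]; field_simp; ring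
    have : 0 < ε / ν := by positivity
    linarith
  -- the asymptotic bound
  obtain ⟨S, hS⟩ : ∃ S : Set ℝ, S = {B : ℝ | ∃ N : ℤ, ∀ k, N ≤ k → |q k| ≤ B} := ⟨_, rfl⟩
  have hSne : S.Nonempty := ⟨1 / 2, by
    rw [hS]; exact ⟨0, fun k hk => hbdd k.toNat k (by omega)⟩⟩
  have hS0 : ∀ B ∈ S, 0 ≤ B := by
    intro B hB
    rw [hS] at hB
    obtain ⟨N, hN⟩ := hB
    exact (abs_nonneg _).trans (hN N le_rfl)
  have hSb : BddBelow S := ⟨0, hS0⟩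
  have hgt : ∀ B, sInf S < B → ∃ N : ℤ, ∀ k, N ≤ k → |q k| ≤ B := by
    intro B hB
    obtain ⟨B', hB', hlt⟩ := exists_lt_of_csInf_lt hSne hB
    rw [hS] at hB'
    obtain ⟨N, hN⟩ := hB'
    exact ⟨N, fun k hk => (hN k hk).trans hlt.le⟩
  have hA : sInf S = 0 := by
    by_contra hne
    have hpos : 0 < sInf S := lt_of_le_of_ne (le_csInf hSne hS0) (Ne.symm hne)
    obtain ⟨A, hAe⟩ : ∃ A, A = sInf S := ⟨_, rfl⟩
    rw [← hAe] at hpos hgt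
    have hε : 0 < A / C := div_pos hpos hC0
    obtain ⟨N, hN⟩ := hgt (A + A / C) (by linarith)
    have hnot : A - A / C ∉ S := fun h => by linarith [csInf_le hSb h]
    rw [hS] at hnot
    simp only [Set.mem_setOf_eq, not_exists, not_forall, not_le] at hnot
    obtain ⟨k, hk, hqk⟩ := hnot (max N 0 + 4 * m + 1)
    have hbig : ∃ k', max N 0 + 2 * m + 1 ≤ k' ∧ A - A / C < q k' := by
      rcases lt_abs.1 hqk with h | h
      · exact ⟨k, by omega, h⟩
      · obtain ⟨π, hπ⟩ := hKne
        have hu := hub k (by omega) π hπ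
        by_contra! hcon
        have := habs π hπ (A - A / C) (fun i : Fin m => q (k - ((i : ℕ) + 1)))
          (fun i => hcon _ (by have := i.2; omega))
        linarith
    obtain ⟨k', hk', hq'⟩ := hbig
    have := key A (A / C) k' hε (by omega) (fun j hj => hN j (by omega)) hq'
    rw [mul_div_cancel₀ _ hC0.ne'] at this
    linarith
  rw [hA] at hgt
  rw [Metric.tendsto_atTop]
  intro ε hε
  obtain ⟨N, hN⟩ := hgt (ε / 2) (by linarith)
  refine ⟨N.toNat, fun n hn => ?_⟩
  rw [Real.dist_eq, ← hq]
  linarith [hN n (by omega)]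
end

section
/- (Monotonicity lemma) For every integer k > 1, Δ_k ≤ Δ̄_{k−1}. -/
/-- `Dbar m p k` is `max_{j in W_k} |p j - 1/2|` where `W_k = {k, k-1, ..., k-m+1}`
(a maximum of a finite nonempty set, expressed as a supremum). -/
noncomputable def Dbar (m : ℕ) (p : ℤ → ℝ) (k : ℤ) : ℝ :=
  sSup {x : ℝ | ∃ i : ℕ, i < m ∧ x = |p (k - i) - 1/2|}

theorem stmt_2
    (m : ℕ) (hm : 1 < m)
    (K : Set (Fin m → ℝ)) (hKne : K.Nonempty) (hKcpt : IsCompact K)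
    (hKsub : ∀ π ∈ K, (∀ i, 0 ≤ π i) ∧ ∑ i, π i = 1)
    (p : ℤ → ℝ)
    (hp0 : ∀ s : ℤ, s ≤ 0 → p s = 1)
    (hpk : ∀ k : ℤ, 1 ≤ k →
      IsGreatest {x : ℝ | ∃ π ∈ K, x = 1 - ∑ i : Fin m, π i * p (k - ((i : ℕ) + 1))} (p k)) :
    ∀ k : ℤ, 1 < k → |p k - 1/2| ≤ Dbar m p (k - 1) := by
  intro k hk
  obtain ⟨⟨π, hπ, hx⟩, -⟩ := hpk k (by omega)
  obtain ⟨h0, h1⟩ := hKsub π hπ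
  have hfin : {x : ℝ | ∃ i : ℕ, i < m ∧ x = |p (k - 1 - i) - 1/2|}.Finite := by
    refine ((Finset.range m).finite_toSet.image
      (fun i : ℕ => |p (k - 1 - i) - 1/2|)).subset ?_
    rintro x ⟨i, hi, rfl⟩
    exact ⟨i, by simpa using hi, rfl⟩
  have hle : ∀ i : Fin m, |p (k - ((i : ℕ) + 1)) - 1/2| ≤ Dbar m p (k - 1) := by
    intro i
    refine le_csSup hfin.bddAbove ⟨i, i.2, ?_⟩
    rw [show k - ((i : ℕ) + 1 : ℤ) = k - 1 - (i : ℕ) by ring]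
  have key : p k - 1/2 = -∑ i : Fin m, π i * (p (k - ((i : ℕ) + 1)) - 1/2) := by
    simp only [mul_sub, Finset.sum_sub_distrib, ← Finset.sum_mul, h1]
    rw [hx]
    ring
  rw [key, abs_neg]
  calc |∑ i : Fin m, π i * (p (k - ((i : ℕ) + 1)) - 1/2)|
      ≤ ∑ i : Fin m, |π i * (p (k - ((i : ℕ) + 1)) - 1/2)| := Finset.abs_sum_le_sum_abs _ _
    _ ≤ ∑ i : Fin m, π i * Dbar m p (k - 1) := by
        refine Finset.sum_le_sum fun i _ => ?_
        rw [abs_mul, abs_of_nonneg (h0 i)]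
        exact mul_le_mul_of_nonneg_left (hle i) (h0 i)
    _ = Dbar m p (k - 1) := by rw [← Finset.sum_mul, h1, one_mul]
end

section
/- For every integer k > 1, Δ̄_k ≤ Δ̄_{k−1}, i.e. the sequence (Δ̄_k) is non-increasing. -/
theorem stmt_3
    (m : ℕ) (hm : 1 < m)
    (K : Set (Fin m → ℝ)) (hKne : K.Nonempty) (hKcpt : IsCompact K)
    (hKsub : ∀ π ∈ K, (∀ i, 0 ≤ π i) ∧ ∑ i, π i = 1)
    (p : ℤ → ℝ)
    (hp0 : ∀ s : ℤ, s ≤ 0 → p s = 1)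
    (hpk : ∀ k : ℤ, 1 ≤ k →
      IsGreatest {x : ℝ | ∃ π ∈ K, x = 1 - ∑ i : Fin m, π i * p (k - ((i : ℕ) + 1))} (p k)) :
    ∀ k : ℤ, 1 < k → Dbar m p k ≤ Dbar m p (k - 1) := by
  intro k hk
  have hfin : BddAbove {x : ℝ | ∃ i : ℕ, i < m ∧ x = |p (k - 1 - i) - 1/2|} := by
    have : {x : ℝ | ∃ i : ℕ, i < m ∧ x = |p (k - 1 - i) - 1/2|}
        = (fun i : ℕ => |p (k - 1 - i) - 1/2|) '' (Set.Iio m) := by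
      ext x
      constructor
      · rintro ⟨i, hi, rfl⟩
        exact ⟨i, hi, rfl⟩
      · rintro ⟨i, hi, rfl⟩
        exact ⟨i, hi, rfl⟩
    rw [this]
    exact ((Set.finite_Iio m).image _).bddAbove
  have hle : ∀ i : ℕ, i < m → |p (k - 1 - i) - 1/2| ≤ Dbar m p (k - 1) :=
    fun i hi => le_csSup hfin ⟨i, hi, rfl⟩
  refine csSup_le (s := {x : ℝ | ∃ i : ℕ, i < m ∧ x = |p (k - i) - 1/2|}) ⟨_, 0, by omega, rfl⟩ ?_
  rintro x ⟨i, hi, rfl⟩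
  rcases i with _ | i
  · obtain ⟨π, hπ, he⟩ := (hpk k hk.le).1
    obtain ⟨h0, h1⟩ := hKsub π hπ
    have e : p (k - ((0 : ℕ) : ℤ)) - 1/2
        = - ∑ i : Fin m, π i * (p (k - ((i : ℕ) + 1)) - 1/2) := by
      simp only [mul_sub, Finset.sum_sub_distrib, ← Finset.sum_mul, h1]
      simp only [Nat.cast_zero, sub_zero]
      linarith
    rw [e, abs_neg]
    calc |∑ i : Fin m, π i * (p (k - ((i : ℕ) + 1)) - 1/2)|
        ≤ ∑ i : Fin m, |π i * (p (k - ((i : ℕ) + 1)) - 1/2)| := Finset.abs_sum_le_sum_abs _ _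
      _ ≤ ∑ i : Fin m, π i * Dbar m p (k - 1) := by
        apply Finset.sum_le_sum
        intro i _
        rw [abs_mul, abs_of_nonneg (h0 i)]
        apply mul_le_mul_of_nonneg_left _ (h0 i)
        have := hle i i.2
        rwa [show k - 1 - ((i : ℕ) : ℤ) = k - ((i : ℕ) + 1) by ring] at this
      _ = Dbar m p (k - 1) := by rw [← Finset.sum_mul, h1, one_mul]
  · have := hle i (by omega)
    rwa [show k - 1 - (i : ℤ) = k - ((i + 1 : ℕ) : ℤ) by push_cast; ring] at this
end

section
/- (No long winning series) Assume that for some integer k > m one has p_j > 1/2 for all j ∈ W_k = {k, k−1, …, k−m+1}. Then p_{k+1} < 1/2 and p_{k−m} ≤ 1/2. -/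
theorem stmt_4
    (m : ℕ) (hm : 1 < m)
    (K : Set (Fin m → ℝ)) (hKne : K.Nonempty) (hKcpt : IsCompact K)
    (hKsub : ∀ π ∈ K, (∀ i, 0 ≤ π i) ∧ ∑ i, π i = 1)
    (p : ℤ → ℝ)
    (hp0 : ∀ s : ℤ, s ≤ 0 → p s = 1)
    (hpk : ∀ k : ℤ, 1 ≤ k →
      IsGreatest {x : ℝ | ∃ π ∈ K, x = 1 - ∑ i : Fin m, π i * p (k - ((i : ℕ) + 1))} (p k))
    (k : ℤ) (hk : (m : ℤ) < k)
    (hW : ∀ i : ℕ, i < m → 1/2 < p (k - i)) :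
    p (k + 1) < 1/2 ∧ p (k - m) ≤ 1/2 := by
  have key : ∀ n : ℤ, 1 ≤ n → (∀ i : ℕ, i < m → 1/2 < p (n - (i + 1))) → p n < 1/2 := by
    intro n hn h
    obtain ⟨π, hπ, he⟩ := (hpk n hn).1
    obtain ⟨h0, h1⟩ := hKsub π hπ
    have hlt : ∑ i : Fin m, π i * (1/2) < ∑ i : Fin m, π i * p (n - ((i : ℕ) + 1)) := by
      apply Finset.sum_lt_sum
      · intro i _
        exact mul_le_mul_of_nonneg_left (h i i.2).le (h0 i)
      · obtain ⟨i, hi, hpos⟩ : ∃ i ∈ (Finset.univ : Finset (Fin m)), 0 < π i := by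
          apply Finset.exists_lt_of_sum_lt
          simp [h1]
        exact ⟨i, hi, mul_lt_mul_of_pos_left (h i i.2) hpos⟩
    rw [← Finset.sum_mul, h1] at hlt
    linarith
  constructor
  · apply key (k + 1) (by omega)
    intro i hi
    have := hW i hi
    rwa [show k + 1 - ((i : ℤ) + 1) = k - i by ring]
  · by_contra hc
    push Not at hc
    have h1 : p k < 1/2 := by
      apply key k (by omega)
      intro i hi
      rcases Nat.lt_or_ge (i + 1) m with h | h
      · have := hW (i + 1) h
        push_cast at this
        exact this
      · have : (m : ℤ) = i + 1 := by omega
        rwa [this] at hc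
    have h2 := hW 0 (by omega)
    simp only [Nat.cast_zero, sub_zero] at h2
    linarith
end

section
/- Assume that for some κ ∈ (0,1) and some integer k > m, the inequality p_j ≥ 1/2 + (1−κ)·Δ_{k+1} holds for all j ∈ W_k = {k, k−1, …, k−m+1}, with strict inequality p_j > 1/2 for all j ∈ W_k. Then Δ_{k+1} ≤ (η / ((2−η)(1−κ))) · Δ_{k−m}. -/
theorem stmt_5
    (m : ℕ) (hm : 1 < m)
    (K : Set (Fin m → ℝ)) (hKne : K.Nonempty) (hKcpt : IsCompact K)
    (hKsub : ∀ π ∈ K, (∀ i, 0 ≤ π i) ∧ ∑ i, π i = 1)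
    (p : ℤ → ℝ)
    (hp0 : ∀ s : ℤ, s ≤ 0 → p s = 1)
    (hpk : ∀ k : ℤ, 1 ≤ k →
      IsGreatest {x : ℝ | ∃ π ∈ K, x = 1 - ∑ i : Fin m, π i * p (k - ((i : ℕ) + 1))} (p k))
    (η : ℝ) (hη : IsGreatest {x : ℝ | ∃ π ∈ K, ∃ i : Fin m, x = π i} η) (hη1 : η < 1)
    (κ : ℝ) (hκ : κ ∈ Set.Ioo (0 : ℝ) 1)
    (k : ℤ) (hk : (m : ℤ) < k)
    (hW : ∀ i : ℕ, i < m → 1/2 + (1 - κ) * |p (k + 1) - 1/2| ≤ p (k - i))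
    (hWs : ∀ i : ℕ, i < m → 1/2 < p (k - i)) :
    |p (k + 1) - 1/2| ≤ η / ((2 - η) * (1 - κ)) * |p (k - m) - 1/2| := by
  obtain ⟨n, rfl⟩ : ∃ n, m = n + 1 := ⟨m - 1, by omega⟩
  obtain ⟨π, hπ, hpkeq⟩ := (hpk k (by push_cast at hk; omega)).1
  obtain ⟨hπ0, hπ1⟩ := hKsub π hπ
  have hlast : π (Fin.last n) ≤ η := hη.2 ⟨π, hπ, Fin.last n, rfl⟩
  have hl0 := hπ0 (Fin.last n)
  rw [Fin.sum_univ_castSucc] at hπ1 hpkeq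
  have h0 := hW 0 (by omega)
  simp only [Nat.cast_zero, sub_zero] at h0
  set D := |p (k + 1) - 1/2| with hD
  have hD0 : 0 ≤ D := abs_nonneg _
  have hsum : (∑ i : Fin n, π i.castSucc) * (1/2 + (1 - κ) * D) ≤
      ∑ i : Fin n, π i.castSucc * p (k - (((i.castSucc : Fin (n+1)) : ℕ) + 1)) := by
    rw [Finset.sum_mul]
    refine Finset.sum_le_sum fun i _ => mul_le_mul_of_nonneg_left ?_ (hπ0 _)
    have := hW (i + 1) (by have := i.2; omega)
    push_cast at this
    simpa using this
  have hidx : k - (((Fin.last n : Fin (n+1)) : ℕ) + 1 : ℤ) = k - ((n + 1 : ℕ) : ℤ) := by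
    simp
  rw [hidx] at hpkeq
  set q := p (k - ((n + 1 : ℕ) : ℤ)) with hq
  set t := π (Fin.last n) with ht
  have hs : (∑ i : Fin n, π i.castSucc) = 1 - t := by linarith
  rw [hs] at hsum
  have hκ1 : 0 < 1 - κ := by linarith [hκ.2]
  have hE : 0 ≤ (1 - κ) * D := mul_nonneg hκ1.le hD0
  have h1 : (2 - t) * ((1 - κ) * D) ≤ t * -(q - 1/2) := by linarith
  have h2 : t * -(q - 1/2) ≤ t * |q - 1/2| := mul_le_mul_of_nonneg_left (neg_le_abs _) hl0
  have h3 : t * |q - 1/2| ≤ η * |q - 1/2| := mul_le_mul_of_nonneg_right hlast (abs_nonneg _)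
  have h4 : (2 - η) * ((1 - κ) * D) ≤ (2 - t) * ((1 - κ) * D) :=
    mul_le_mul_of_nonneg_right (by linarith) hE
  have hpos : 0 < (2 - η) * (1 - κ) := mul_pos (by linarith) hκ1
  rw [div_mul_eq_mul_div, le_div_iff₀ hpos]
  linarith
end

section
/- (Corridor lemma) Assume that for some integer k ≥ 1 one has p_{k+1} < 1/2. Then max_{i∈W_k} ( p_i − (1/2 + Δ_{k+1}) ) ≥ (ν/(1−ν)) · max_{i∈W_k} ( 1/2 + Δ_{k+1} − p_i ), where W_k = {k, k−1, …, k−m+1}. -/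
theorem stmt_6
    (m : ℕ) (hm : 1 < m)
    (K : Set (Fin m → ℝ)) (hKne : K.Nonempty) (hKcpt : IsCompact K)
    (hKsub : ∀ π ∈ K, (∀ i, 0 ≤ π i) ∧ ∑ i, π i = 1)
    (p : ℤ → ℝ)
    (hp0 : ∀ s : ℤ, s ≤ 0 → p s = 1)
    (hpk : ∀ k : ℤ, 1 ≤ k →
      IsGreatest {x : ℝ | ∃ π ∈ K, x = 1 - ∑ i : Fin m, π i * p (k - ((i : ℕ) + 1))} (p k))
    (η : ℝ) (hη : IsGreatest {x : ℝ | ∃ π ∈ K, ∃ i : Fin m, x = π i} η) (hη1 : η < 1)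
    (ν : ℝ)
    (hν : IsLeast {x : ℝ | ∃ i : Fin m, IsGreatest {y : ℝ | ∃ π ∈ K, y = π i} x} ν)
    (hν0 : 0 < ν)
    (k : ℤ) (hk : 1 ≤ k) (hlose : p (k + 1) < 1/2) :
    sSup {x : ℝ | ∃ i : ℕ, i < m ∧ x = p (k - i) - (1/2 + |p (k + 1) - 1/2|)} ≥
      ν / (1 - ν) *
        sSup {x : ℝ | ∃ i : ℕ, i < m ∧ x = 1/2 + |p (k + 1) - 1/2| - p (k - i)} := by
  have habs : 1/2 + |p (k + 1) - 1/2| = 1 - p (k + 1) := by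
    rw [abs_of_neg (by linarith)]; ring
  rw [habs]
  set c := 1 - p (k + 1) with hc
  have hfin1 : {x : ℝ | ∃ i : ℕ, i < m ∧ x = p (k - i) - c}.Finite := by
    refine ((Set.finite_lt_nat m).image (fun i : ℕ => p (k - i) - c)).subset ?_
    rintro x ⟨i, hi, rfl⟩
    exact ⟨i, hi, rfl⟩
  have hfin2 : {x : ℝ | ∃ i : ℕ, i < m ∧ x = c - p (k - i)}.Finite := by
    refine ((Set.finite_lt_nat m).image (fun i : ℕ => c - p (k - i))).subset ?_
    rintro x ⟨i, hi, rfl⟩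
    exact ⟨i, hi, rfl⟩
  have hne2 : {x : ℝ | ∃ i : ℕ, i < m ∧ x = c - p (k - i)}.Nonempty := ⟨_, 0, by omega, rfl⟩
  obtain ⟨j, hj, hD⟩ := hne2.csSup_mem hfin2
  rw [hD]
  have hM : ∀ i : ℕ, i < m →
      p (k - i) - c ≤ sSup {x : ℝ | ∃ i : ℕ, i < m ∧ x = p (k - i) - c} :=
    fun i hi => le_csSup hfin1.bddAbove ⟨i, hi, rfl⟩
  generalize sSup {x : ℝ | ∃ i : ℕ, i < m ∧ x = p (k - i) - c} = M at hM ⊢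
  obtain ⟨π, hπ, hmax⟩ := hKcpt.exists_isMaxOn hKne
    (continuous_apply (⟨j, hj⟩ : Fin m)).continuousOn
  have hw : ν ≤ π ⟨j, hj⟩ := by
    apply hν.2
    refine ⟨⟨j, hj⟩, ⟨π, hπ, rfl⟩, ?_⟩
    rintro y ⟨q, hq, rfl⟩
    exact hmax hq
  have hw1 : π ⟨j, hj⟩ < 1 := lt_of_le_of_lt (hη.2 ⟨π, hπ, _, rfl⟩) hη1
  obtain ⟨hpos, hsum⟩ := hKsub π hπ
  have h1 := (hpk (k + 1) (by omega)).2 ⟨π, hπ, rfl⟩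
  have h2 : ∑ i : Fin m, π i * p (k + 1 - ((i : ℕ) + 1)) = ∑ i : Fin m, π i * p (k - (i : ℕ)) := by
    refine Finset.sum_congr rfl fun i _ => ?_
    congr 2; ring
  rw [h2] at h1
  have h3 : ∑ i : Fin m, π i * (M + c - p (k - (i : ℕ)))
      = M + c - ∑ i : Fin m, π i * p (k - (i : ℕ)) := by
    simp only [mul_sub, Finset.sum_sub_distrib]
    rw [← Finset.sum_mul, hsum, one_mul]
  have h4 : π ⟨j, hj⟩ * (M + c - p (k - (j : ℕ)))
      ≤ ∑ i : Fin m, π i * (M + c - p (k - (i : ℕ))) :=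
    Finset.single_le_sum (f := fun i : Fin m => π i * (M + c - p (k - (i : ℕ))))
      (fun i _ => mul_nonneg (hpos i) (by linarith [hM i i.2])) (Finset.mem_univ (⟨j, hj⟩ : Fin m))
  have hMj := hM j hj
  generalize p (k - (j : ℕ)) = P at *
  generalize π ⟨j, hj⟩ = w at *
  have h5 : w * (M + c - P) ≤ M := by linarith
  have h6 : ν * (M + c - P) ≤ M :=
    le_trans (mul_le_mul_of_nonneg_right hw (by linarith)) h5
  rw [ge_iff_le, div_mul_eq_mul_div, div_le_iff₀ (by linarith)]
  linarith
end

section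
/- Let τ be any real number with 0 < τ < (ν/(1−ν))·(2−2η)/(2−η), and set δ := max{ (η/(2−η))·(ν/(ν−τ+ντ)), 1/(1+τ) }. Then 0 < δ < 1, and for every integer k > m with p_{k+1} < 1/2 one has Δ_{k+1} ≤ δ · Δ̄_{k−m}. -/
theorem stmt_7
    (m : ℕ) (hm : 1 < m)
    (K : Set (Fin m → ℝ)) (hKne : K.Nonempty) (hKcpt : IsCompact K)
    (hKsub : ∀ π ∈ K, (∀ i, 0 ≤ π i) ∧ ∑ i, π i = 1)
    (p : ℤ → ℝ)
    (hp0 : ∀ s : ℤ, s ≤ 0 → p s = 1)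
    (hpk : ∀ k : ℤ, 1 ≤ k →
      IsGreatest {x : ℝ | ∃ π ∈ K, x = 1 - ∑ i : Fin m, π i * p (k - ((i : ℕ) + 1))} (p k))
    (η : ℝ) (hη : IsGreatest {x : ℝ | ∃ π ∈ K, ∃ i : Fin m, x = π i} η) (hη1 : η < 1)
    (ν : ℝ)
    (hν : IsLeast {x : ℝ | ∃ i : Fin m, IsGreatest {y : ℝ | ∃ π ∈ K, y = π i} x} ν)
    (hν0 : 0 < ν)
    (τ : ℝ) (hτ0 : 0 < τ) (hτ1 : τ < ν / (1 - ν) * ((2 - 2 * η) / (2 - η)))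
    (δ : ℝ) (hδ : δ = max (η / (2 - η) * (ν / (ν - τ + ν * τ))) (1 / (1 + τ))) :
    0 < δ ∧ δ < 1 ∧
      ∀ k : ℤ, (m : ℤ) < k → p (k + 1) < 1/2 →
        |p (k + 1) - 1/2| ≤ δ * Dbar m p (k - m) := by
  -- basic facts on the weights
  have hm0 : 0 < m := by omega
  have hle : ∀ π ∈ K, ∀ i, π i ≤ η := fun π hπ i => hη.2 ⟨π, hπ, i, rfl⟩
  have hex : ∀ i : Fin m, ∃ π ∈ K, ν ≤ π i := by
    intro i
    obtain ⟨π, hπ, hmax⟩ := hKcpt.exists_isMaxOn hKne (continuous_apply i).continuousOn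
    refine ⟨π, hπ, hν.2 ⟨i, ⟨π, hπ, rfl⟩, ?_⟩⟩
    rintro y ⟨π', hπ', rfl⟩
    exact hmax hπ'
  have hνη : ν ≤ η := by
    obtain ⟨π, hπ, h⟩ := hex ⟨0, hm0⟩
    exact h.trans (hle π hπ _)
  have hη0 : 0 < η := by linarith
  have h1ν : 0 < 1 - ν := by linarith
  have h2η : 0 < 2 - η := by linarith
  have hτ2 : τ * (1 - ν) * (2 - η) < ν * (2 - 2 * η) := by
    rw [div_mul_div_comm, lt_div_iff₀ (by positivity)] at hτ1
    linarith
  obtain ⟨e, he⟩ : ∃ e, e = ν - τ + ν * τ := ⟨_, rfl⟩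
  rw [← he] at hδ
  have heη : η * ν < e * (2 - η) := by rw [he]; nlinarith
  have he0 : 0 < e := by
    have : 0 < e * (2 - η) := lt_trans (by positivity) heη
    exact pos_of_mul_pos_left this h2η.le
  refine ⟨?_, ?_, ?_⟩
  · rw [hδ]; exact lt_max_of_lt_right (by positivity)
  · rw [hδ]
    apply max_lt
    · rw [div_mul_div_comm, div_lt_one (by positivity)]
      linarith
    · rw [div_lt_one (by positivity)]; linarith
  intro k hk hpk1
  obtain ⟨M, hM⟩ : ∃ M, M = Dbar m p (k - m) := ⟨_, rfl⟩
  rw [← hM]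
  have hbase : ∀ i : ℕ, i < m → |p (k - m - i) - 1/2| ≤ M := by
    intro i hi
    rw [hM]
    apply le_csSup
    · apply Set.Finite.bddAbove
      apply ((Set.finite_lt_nat m).image (fun i : ℕ => |p (k - m - i) - 1/2|)).subset
      rintro x ⟨i, hi, rfl⟩
      exact ⟨i, hi, rfl⟩
    · exact ⟨i, hi, rfl⟩
  have hM0 : 0 ≤ M := (abs_nonneg _).trans (hbase 0 hm0)
  -- the recursion for the centred sequence
  have hcent : ∀ π ∈ K, ∀ j : ℤ, ∑ i : Fin m, π i * (p (j - ((i : ℕ) + 1)) - 1/2)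
      = ∑ i : Fin m, π i * p (j - ((i : ℕ) + 1)) - 1/2 := by
    intro π hπ j
    simp only [mul_sub, Finset.sum_sub_distrib, ← Finset.sum_mul, (hKsub π hπ).2, one_mul]
  have hrec : ∀ j : ℤ, 1 ≤ j → ∃ π ∈ K,
      p j - 1/2 = -∑ i : Fin m, π i * (p (j - ((i : ℕ) + 1)) - 1/2) := by
    intro j hj
    obtain ⟨π, hπ, h⟩ := (hpk j hj).1
    refine ⟨π, hπ, ?_⟩
    rw [hcent π hπ j, h]; ring
  have hall : ∀ n : ℕ, |p (k - 2 * m + 1 + n) - 1/2| ≤ M := by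
    intro n
    induction n using Nat.strong_induction_on with
    | _ n ih =>
      by_cases hn : n < m
      · have := hbase (m - 1 - n) (by omega)
        convert this using 4
        omega
      · obtain ⟨π, hπ, h⟩ := hrec (k - 2 * m + 1 + n) (by omega)
        rw [h, abs_neg]
        calc _ ≤ ∑ i : Fin m, |π i * (p (k - 2 * m + 1 + n - ((i : ℕ) + 1)) - 1/2)| :=
              Finset.abs_sum_le_sum_abs _ _
          _ ≤ ∑ i : Fin m, π i * M := by
              apply Finset.sum_le_sum
              intro i _
              rw [abs_mul, abs_of_nonneg ((hKsub π hπ).1 i)]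
              apply mul_le_mul_of_nonneg_left _ ((hKsub π hπ).1 i)
              have hi := i.isLt
              have := ih (n - 1 - (i : ℕ)) (by omega)
              have hidx : k - 2 * m + 1 + n - (((i : ℕ) : ℤ) + 1)
                  = k - 2 * m + 1 + ((n - 1 - (i : ℕ) : ℕ) : ℤ) := by omega
              rw [hidx]
              exact this
          _ = M := by rw [← Finset.sum_mul, (hKsub π hπ).2, one_mul]
  have hall' : ∀ j : ℤ, k - 2 * m + 1 ≤ j → |p j - 1/2| ≤ M := by
    intro j hj
    have := hall (j - (k - 2 * m + 1)).toNat
    convert this using 4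
    omega
  rw [abs_of_neg (by linarith)]
  obtain ⟨D, hD⟩ : ∃ D, D = -(p (k + 1) - 1/2) := ⟨_, rfl⟩
  rw [← hD]
  have hD0 : 0 < D := by linarith
  by_cases hcase : D ≤ 1 / (1 + τ) * M
  · refine hcase.trans (mul_le_mul_of_nonneg_right ?_ hM0)
    rw [hδ]; exact le_max_right _ _
  push Not at hcase
  have hMD : M < (1 + τ) * D := by
    rw [one_div, inv_mul_lt_iff₀ (by positivity)] at hcase
    exact hcase
  -- every entry in the window `W_k` is bounded below
  have hlow : ∀ i : Fin m, e * D ≤ ν * (p (k + 1 - ((i : ℕ) + 1)) - 1/2) := by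
    intro i
    obtain ⟨π, hπ, hi⟩ := hex i
    have h1 : 1 - ∑ i : Fin m, π i * p (k + 1 - ((i : ℕ) + 1)) ≤ p (k + 1) :=
      (hpk (k + 1) (by omega)).2 ⟨π, hπ, rfl⟩
    have h2 := hcent π hπ (k + 1)
    have h3 : D ≤ ∑ i : Fin m, π i * (p (k + 1 - ((i : ℕ) + 1)) - 1/2) := by
      rw [h2]; linarith
    have hub : ∀ l : Fin m, p (k + 1 - ((l : ℕ) + 1)) - 1/2 ≤ M := fun l =>
      (le_abs_self _).trans (hall' _ (by omega))
    have h4 : ∑ l : Fin m, π l * (M - (p (k + 1 - ((l : ℕ) + 1)) - 1/2)) =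
        M - ∑ i : Fin m, π i * (p (k + 1 - ((i : ℕ) + 1)) - 1/2) := by
      simp only [mul_sub _ M, Finset.sum_sub_distrib, ← Finset.sum_mul,
        (hKsub π hπ).2, one_mul]
    have h5 : π i * (M - (p (k + 1 - ((i : ℕ) + 1)) - 1/2)) ≤
        ∑ l : Fin m, π l * (M - (p (k + 1 - ((l : ℕ) + 1)) - 1/2)) :=
      Finset.single_le_sum (f := fun l : Fin m => π l * (M - (p (k + 1 - ((l : ℕ) + 1)) - 1/2)))
        (fun l _ => mul_nonneg ((hKsub π hπ).1 l) (by linarith [hub l])) (Finset.mem_univ i)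
    have h6 : ν * (M - (p (k + 1 - ((i : ℕ) + 1)) - 1/2)) ≤
        π i * (M - (p (k + 1 - ((i : ℕ) + 1)) - 1/2)) :=
      mul_le_mul_of_nonneg_right hi (by linarith [hub i])
    have h7 : (1 - ν) * M ≤ (1 - ν) * ((1 + τ) * D) :=
      mul_le_mul_of_nonneg_left hMD.le h1ν.le
    rw [he]
    nlinarith
  -- apply the recursion at `k`
  obtain ⟨π, hπ, hk'⟩ := hrec k (by omega)
  let z : Fin m := ⟨m - 1, by omega⟩
  have h8 : (1 - π z) * (e * D) - π z * (ν * M) ≤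
      ν * ∑ i : Fin m, π i * (p (k - ((i : ℕ) + 1)) - 1/2) := by
    have hs := (hKsub π hπ).2
    rw [← Finset.add_sum_erase _ _ (Finset.mem_univ z)] at hs ⊢
    have ha : -M ≤ p (k - ((z : ℕ) + 1)) - 1/2 :=
      neg_le_of_abs_le (hall' _ (by omega))
    have hb : (∑ i ∈ Finset.univ.erase z, π i) * (e * D) ≤
        ν * ∑ i ∈ Finset.univ.erase z, π i * (p (k - ((i : ℕ) + 1)) - 1/2) := by
      rw [Finset.sum_mul, Finset.mul_sum]
      apply Finset.sum_le_sum
      intro i hi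
      have hiz : (i : ℕ) ≠ m - 1 := fun h => (Finset.ne_of_mem_erase hi) (Fin.ext h)
      have h := hlow ⟨i + 1, by omega⟩
      have hidx : k + 1 - (((i : ℕ) + 1 : ℕ) + 1 : ℤ) = k - ((i : ℕ) + 1) := by push_cast; ring
      simp only [hidx] at h
      have := mul_le_mul_of_nonneg_left h ((hKsub π hπ).1 i)
      linarith
    have hc : (∑ i ∈ Finset.univ.erase z, π i) = 1 - π z := by linarith
    rw [hc] at hb
    have hd := mul_le_mul_of_nonneg_left ha (mul_nonneg hν0.le ((hKsub π hπ).1 z))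
    linarith
  have h9 := hlow ⟨0, hm0⟩
  have hidx : k + 1 - (((0 : ℕ) : ℤ) + 1) = k := by push_cast; ring
  simp only [hidx] at h9
  rw [hk'] at h9
  have h10 : e * D * (2 - π z) ≤ π z * (ν * M) := by linarith
  have h11 : e * D * (2 - η) ≤ η * (ν * M) := by
    have hz := hle π hπ z
    have h12 : π z * (ν * M) ≤ η * (ν * M) := mul_le_mul_of_nonneg_right hz (by positivity)
    have h13 : e * D * (2 - η) ≤ e * D * (2 - π z) :=
      mul_le_mul_of_nonneg_left (by linarith) (by positivity)
    linarith
  have h14 : D ≤ η / (2 - η) * (ν / e) * M := by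
    rw [div_mul_div_comm, div_mul_eq_mul_div, le_div_iff₀ (by positivity)]
    linarith
  refine h14.trans (mul_le_mul_of_nonneg_right ?_ hM0)
  rw [hδ]; exact le_max_left _ _
end

section
/- (Drop down for losing positions, existence form) There exists a real number δ with 0 < δ < 1, depending only on m and K, such that for every integer k > m with p_{k+1} < 1/2 one has Δ_{k+1} ≤ δ · Δ̄_{k−m}. -/
theorem stmt_8
    (m : ℕ) (hm : 1 < m)
    (K : Set (Fin m → ℝ)) (hKne : K.Nonempty) (hKcpt : IsCompact K)
    (hKsub : ∀ π ∈ K, (∀ i, 0 ≤ π i) ∧ ∑ i, π i = 1)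
    (p : ℤ → ℝ)
    (hp0 : ∀ s : ℤ, s ≤ 0 → p s = 1)
    (hpk : ∀ k : ℤ, 1 ≤ k →
      IsGreatest {x : ℝ | ∃ π ∈ K, x = 1 - ∑ i : Fin m, π i * p (k - ((i : ℕ) + 1))} (p k))
    (η : ℝ) (hη : IsGreatest {x : ℝ | ∃ π ∈ K, ∃ i : Fin m, x = π i} η) (hη1 : η < 1)
    (ν : ℝ)
    (hν : IsLeast {x : ℝ | ∃ i : Fin m, IsGreatest {y : ℝ | ∃ π ∈ K, y = π i} x} ν)
    (hν0 : 0 < ν) :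
    ∃ δ : ℝ, 0 < δ ∧ δ < 1 ∧
      ∀ k : ℤ, (m : ℤ) < k → p (k + 1) < 1/2 →
        |p (k + 1) - 1/2| ≤ δ * Dbar m p (k - m) := by
  obtain ⟨q, hq⟩ : ∃ q : ℤ → ℝ, ∀ j, p j = q j + 1/2 := ⟨fun j => p j - 1/2, fun j => by ring⟩
  have hconv : ∀ π ∈ K, ∀ j : ℤ, 1 - ∑ i : Fin m, π i * p (j - ((i : ℕ) + 1))
      = 1/2 - ∑ i : Fin m, π i * q (j - ((i : ℕ) + 1)) := by
    intro π hπ j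
    have h1 := (hKsub π hπ).2
    simp only [hq, mul_add, Finset.sum_add_distrib]
    rw [← Finset.sum_mul, h1]
    ring
  have hle : ∀ π ∈ K, ∀ i, π i ≤ η := fun π hπ i => hη.2 ⟨π, hπ, i, rfl⟩
  have hex : ∀ i : Fin m, ∃ π ∈ K, ν ≤ π i := by
    intro i
    obtain ⟨π, hπ, hmax⟩ := hKcpt.exists_isMaxOn hKne (continuous_apply i).continuousOn
    refine ⟨π, hπ, hν.2 ⟨i, ⟨π, hπ, rfl⟩, ?_⟩⟩
    rintro y ⟨π', hπ', rfl⟩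
    exact hmax hπ'
  obtain ⟨i0⟩ : Nonempty (Fin m) := ⟨⟨0, by omega⟩⟩
  have hνη : ν ≤ η := by
    obtain ⟨π, hπ, h⟩ := hex i0
    exact h.trans (hle π hπ i0)
  have hδ1 : ν * (1 - η) / 2 < 1 := by nlinarith
  have hδ0 : 0 < ν * (1 - η) / 2 := by
    have : 0 < 1 - η := by linarith
    positivity
  refine ⟨1 - ν * (1 - η) / 2, by linarith, by linarith, ?_⟩
  intro k hk hlt
  obtain ⟨D, hD⟩ : ∃ D, D = Dbar m p (k - m) := ⟨_, rfl⟩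
  rw [← hD]
  have hbase : ∀ n : ℕ, n < m → |q (k - m - n)| ≤ D := by
    intro n hn
    rw [hD]
    refine le_csSup ?_ ⟨n, hn, by rw [hq]; ring_nf⟩
    apply Set.Finite.bddAbove
    refine ((Set.finite_lt_nat m).image (fun i : ℕ => |p (k - m - i) - 1/2|)).subset ?_
    rintro x ⟨i, hi, rfl⟩
    exact ⟨i, hi, rfl⟩
  have hD0 : 0 ≤ D := (abs_nonneg _).trans (hbase 0 (by omega))
  have hall : ∀ n : ℕ, |q (k - 2 * m + 1 + n)| ≤ D := by
    intro n
    induction n using Nat.strong_induction_on with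
    | _ n ih =>
      by_cases hn : n < m
      · have := hbase (m - 1 - n) (by omega)
        have e : k - (m : ℤ) - ((m - 1 - n : ℕ) : ℤ) = k - 2 * m + 1 + n := by omega
        rwa [e] at this
      · obtain ⟨π, hπ, h⟩ := (hpk (k - 2 * m + 1 + n) (by omega)).1
        rw [hconv π hπ, hq] at h
        have h2 : q (k - 2 * m + 1 + n) =
          - ∑ i : Fin m, π i * q (k - 2 * m + 1 + n - ((i : ℕ) + 1)) := by linarith
        rw [h2, abs_neg]
        calc _ ≤ ∑ i : Fin m, |π i * q (k - 2 * m + 1 + n - ((i : ℕ) + 1))| :=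
              Finset.abs_sum_le_sum_abs _ _
          _ ≤ ∑ i : Fin m, π i * D := by
              refine Finset.sum_le_sum fun i _ => ?_
              have h0 := (hKsub π hπ).1 i
              rw [abs_mul, abs_of_nonneg h0]
              refine mul_le_mul_of_nonneg_left ?_ h0
              have := ih (n - (i + 1)) (by omega)
              have e : k - 2 * (m : ℤ) + 1 + ((n - (i + 1) : ℕ) : ℤ)
                = k - 2 * m + 1 + n - ((i : ℕ) + 1) := by omega
              rwa [e] at this
          _ = D := by rw [← Finset.sum_mul, (hKsub π hπ).2, one_mul]
  have hall' : ∀ j : ℤ, k - 2 * m + 1 ≤ j → |q j| ≤ D := by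
    intro j hj
    have := hall (j - (k - 2 * m + 1)).toNat
    have e : k - 2 * (m : ℤ) + 1 + ((j - (k - 2 * m + 1)).toNat : ℤ) = j := by omega
    rwa [e] at this
  by_contra hcon
  push Not at hcon
  rw [abs_of_neg (by linarith), hq] at hcon
  -- all the previous `m` values are close to `D`
  have hnear : ∀ i : Fin m, D * (1 + η) / 2 < q (k + 1 - ((i : ℕ) + 1)) := by
    intro i
    obtain ⟨π, hπ, hi⟩ := hex i
    have h := (hpk (k + 1) (by omega)).2 ⟨π, hπ, rfl⟩
    rw [hconv π hπ, hq] at h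
    have hb : ∀ i : Fin m, q (k + 1 - ((i : ℕ) + 1)) ≤ D := fun i =>
      (le_abs_self _).trans (hall' _ (by omega))
    have h3 : π i * (D - q (k + 1 - ((i : ℕ) + 1))) ≤
        ∑ j : Fin m, π j * (D - q (k + 1 - ((j : ℕ) + 1))) :=
      Finset.single_le_sum (f := fun j : Fin m => π j * (D - q (k + 1 - ((j : ℕ) + 1))))
        (fun j _ => mul_nonneg ((hKsub π hπ).1 j) (by linarith [hb j])) (Finset.mem_univ i)
    simp only [mul_sub, Finset.sum_sub_distrib] at h3
    rw [← Finset.sum_mul, (hKsub π hπ).2, ← mul_sub] at h3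
    have h4 : ν * (D - q (k + 1 - ((i : ℕ) + 1))) ≤ π i * (D - q (k + 1 - ((i : ℕ) + 1))) :=
      mul_le_mul_of_nonneg_right hi (by linarith [hb i])
    have h5 : ν * (D - q (k + 1 - ((i : ℕ) + 1))) < ν * ((1 - η) / 2 * D) := by linarith
    have := lt_of_mul_lt_mul_left h5 hν0.le
    linarith
  have hη0 : 0 < η := by linarith
  have hqk : q k ≤ η * D := by
    obtain ⟨π, hπ, h⟩ := (hpk k (by omega)).1
    rw [hconv π hπ, hq] at h
    have h2 : q k = ∑ i : Fin m, π i * (- q (k - ((i : ℕ) + 1))) := by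
      simp only [mul_neg, Finset.sum_neg_distrib]; linarith
    rw [h2]
    have h3 : ∀ i : Fin m, π i * (- q (k - ((i : ℕ) + 1))) ≤
        if i = ⟨m - 1, by omega⟩ then η * D else 0 := by
      intro i
      have h0 := (hKsub π hπ).1 i
      split_ifs with hi
      · have := (neg_le_abs _).trans (hall' (k - ((i : ℕ) + 1)) (by omega))
        exact (mul_le_mul_of_nonneg_left this h0).trans
          (mul_le_mul_of_nonneg_right (hle π hπ i) hD0)
      · have hi' : (i : ℕ) + 1 < m := by
          have : (i : ℕ) ≠ m - 1 := fun h => hi (Fin.ext h)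
          omega
        have h6 := hnear ⟨i + 1, hi'⟩
        have e : k + 1 - (((i + 1 : ℕ) : ℤ) + 1) = k - ((i : ℕ) + 1) := by push_cast; ring
        simp only [e] at h6
        have : 0 ≤ D * (1 + η) / 2 := by positivity
        exact mul_nonpos_of_nonneg_of_nonpos h0 (by linarith)
    refine (Finset.sum_le_sum fun i _ => h3 i).trans ?_
    simp
  have h7 := hnear ⟨0, by omega⟩
  have e : k + 1 - (((0 : ℕ) : ℤ) + 1) = k := by simp
  simp only [e] at h7
  nlinarith
end

section
/- For every integer k ≥ 1, Δ⁺_{k+1} ≤ Δ̄⁻_k, where Δ⁺_j = max{0, p_j − 1/2}, Δ⁻_j = max{0, 1/2 − p_j}, and Δ̄⁻_k = max_{i∈W_k} Δ⁻_i with W_k = {k, k−1, …, k−m+1}. -/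
/-- `DbarNeg m p k` is `max_{j in W_k} max(0, 1/2 - p j)`. -/
noncomputable def DbarNeg (m : ℕ) (p : ℤ → ℝ) (k : ℤ) : ℝ :=
  sSup {x : ℝ | ∃ i : ℕ, i < m ∧ x = max 0 (1/2 - p (k - i))}

theorem stmt_9
    (m : ℕ) (hm : 1 < m)
    (K : Set (Fin m → ℝ)) (hKne : K.Nonempty) (hKcpt : IsCompact K)
    (hKsub : ∀ π ∈ K, (∀ i, 0 ≤ π i) ∧ ∑ i, π i = 1)
    (p : ℤ → ℝ)
    (hp0 : ∀ s : ℤ, s ≤ 0 → p s = 1)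
    (hpk : ∀ k : ℤ, 1 ≤ k →
      IsGreatest {x : ℝ | ∃ π ∈ K, x = 1 - ∑ i : Fin m, π i * p (k - ((i : ℕ) + 1))} (p k)) :
    ∀ k : ℤ, 1 ≤ k → max 0 (p (k + 1) - 1/2) ≤ DbarNeg m p k := by
  intro k hk
  have hbdd : BddAbove {x : ℝ | ∃ i : ℕ, i < m ∧ x = max 0 (1/2 - p (k - i))} := by
    apply Set.Finite.bddAbove
    refine ((Set.finite_Iio m).image (fun i : ℕ => max 0 (1/2 - p (k - i)))).subset ?_
    rintro x ⟨i, hi, rfl⟩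
    exact ⟨i, hi, rfl⟩
  have hle : ∀ i : ℕ, i < m → max 0 (1/2 - p (k - i)) ≤ DbarNeg m p k := by
    intro i hi
    exact le_csSup hbdd ⟨i, hi, rfl⟩
  apply max_le
  · exact (le_max_left _ _).trans (hle 0 (by omega))
  · obtain ⟨π, hπ, heq⟩ := (hpk (k + 1) (by omega)).1
    obtain ⟨hnn, hsum⟩ := hKsub π hπ
    have h1 : ∑ i : Fin m, π i * (1/2 - p (k + 1 - ((i : ℕ) + 1)))
        ≤ ∑ i : Fin m, π i * DbarNeg m p k := by
      apply Finset.sum_le_sum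
      intro i _
      apply mul_le_mul_of_nonneg_left _ (hnn i)
      have h2 := (le_max_right _ _).trans (hle i i.2)
      have h3 : k + 1 - (((i : ℕ) : ℤ) + 1) = k - ((i : ℕ) : ℤ) := by ring
      rw [h3]
      exact h2
    simp only [mul_sub, Finset.sum_sub_distrib] at h1
    rw [← Finset.sum_mul, ← Finset.sum_mul, hsum] at h1
    linarith
end

section
/- (Drop down for any position) There exists a real number δ with 0 < δ < 1, depending only on m and K, such that for every integer k > 2m one has Δ_{k+1} ≤ δ · Δ̄_{k−2m}. -/
theorem aux_upper (m : ℕ) (π x : Fin m → ℝ) (M : ℝ) (h0 : ∀ i, 0 ≤ π i) (h1 : ∑ i, π i = 1)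
    (hx : ∀ i, |x i| ≤ M) (c : ℝ) (i : Fin m) (hc : c ≤ π i) :
    c * (M - x i) ≤ M - ∑ j, π j * x j := by
  have e : M - ∑ j, π j * x j = ∑ j, π j * (M - x j) := by
    simp only [mul_sub, Finset.sum_sub_distrib, ← Finset.sum_mul, h1, one_mul]
  have hn : ∀ j, 0 ≤ M - x j := fun j => by linarith [le_abs_self (x j), hx j]
  rw [e]
  calc c * (M - x i) ≤ π i * (M - x i) := mul_le_mul_of_nonneg_right hc (hn i)
    _ ≤ _ := Finset.single_le_sum (f := fun j => π j * (M - x j))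
      (fun j _ => mul_nonneg (h0 j) (hn j)) (Finset.mem_univ i)

theorem aux_exists (m : ℕ) (hm : 1 < m) (π : Fin m → ℝ) (h1 : ∑ i, π i = 1)
    (η : ℝ) (hη1 : η < 1) (hη : ∀ i, π i ≤ η) (c : ℝ) (hc : c ≤ (1 - η) / m) :
    ∃ i : Fin m, (i : ℕ) + 1 < m ∧ c ≤ π i := by
  obtain ⟨n, rfl⟩ : ∃ n, m = n + 1 := ⟨m - 1, by omega⟩
  by_contra! hcon
  rw [Fin.sum_univ_castSucc] at h1
  have hs : ∑ i : Fin n, π i.castSucc ≤ ∑ i : Fin n, (1 - η) / ((n + 1 : ℕ) : ℝ) := by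
    apply Finset.sum_le_sum
    intro i _
    have := hcon i.castSucc (by simp)
    linarith
  have hl := hη (Fin.last n)
  simp only [Finset.sum_const, Finset.card_univ, Fintype.card_fin, nsmul_eq_mul] at hs
  have hpos : 0 < (1 - η) / ((n + 1 : ℕ) : ℝ) := by
    apply div_pos <;> [linarith; positivity]
  have : ((n + 1 : ℕ) : ℝ) * ((1 - η) / ((n + 1 : ℕ) : ℝ)) = 1 - η := by
    field_simp
  push_cast at *
  linarith

theorem stmt_10
    (m : ℕ) (hm : 1 < m)
    (K : Set (Fin m → ℝ)) (hKne : K.Nonempty) (hKcpt : IsCompact K)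
    (hKsub : ∀ π ∈ K, (∀ i, 0 ≤ π i) ∧ ∑ i, π i = 1)
    (p : ℤ → ℝ)
    (hp0 : ∀ s : ℤ, s ≤ 0 → p s = 1)
    (hpk : ∀ k : ℤ, 1 ≤ k →
      IsGreatest {x : ℝ | ∃ π ∈ K, x = 1 - ∑ i : Fin m, π i * p (k - ((i : ℕ) + 1))} (p k))
    (η : ℝ) (hη : IsGreatest {x : ℝ | ∃ π ∈ K, ∃ i : Fin m, x = π i} η) (hη1 : η < 1)
    (ν : ℝ)
    (hν : IsLeast {x : ℝ | ∃ i : Fin m, IsGreatest {y : ℝ | ∃ π ∈ K, y = π i} x} ν)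
    (hν0 : 0 < ν) :
    ∃ δ : ℝ, 0 < δ ∧ δ < 1 ∧
      ∀ k : ℤ, 2 * (m : ℤ) < k →
        |p (k + 1) - 1/2| ≤ δ * Dbar m p (k - 2 * m) := by
  have hm0 : (2 : ℝ) ≤ (m : ℝ) := by exact_mod_cast hm
  obtain ⟨c, hc0, hcν, hcη, hc2⟩ : ∃ c : ℝ, 0 < c ∧ c ≤ ν ∧ c ≤ (1 - η) / m ∧ c ≤ 1 / 2 := by
    refine ⟨min ν (min ((1 - η) / m) (1 / 2)), ?_, min_le_left _ _,
      (min_le_right _ _).trans (min_le_left _ _), (min_le_right _ _).trans (min_le_right _ _)⟩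
    have : 0 < (1 - η) / m := div_pos (by linarith) (by linarith)
    exact lt_min hν0 (lt_min this (by norm_num))
  obtain ⟨q, hq⟩ : ∃ q : ℤ → ℝ, ∀ k, q k = p k - 1 / 2 := ⟨_, fun _ => rfl⟩
  have hval : ∀ π ∈ K, ∀ k : ℤ, 1 - ∑ i : Fin m, π i * p (k - ((i : ℕ) + 1))
      = 1 / 2 - ∑ i : Fin m, π i * q (k - ((i : ℕ) + 1)) := by
    intro π hπ k
    simp only [hq, mul_sub, Finset.sum_sub_distrib, ← Finset.sum_mul, (hKsub π hπ).2]
    ring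
  have hA : ∀ (M : ℝ) (k : ℤ), 1 ≤ k → (∀ i : Fin m, |q (k - ((i : ℕ) + 1))| ≤ M) →
      ∃ i : Fin m, (i : ℕ) + 1 < m ∧ c * (M + q (k - ((i : ℕ) + 1))) ≤ M - q k := by
    intro M k hk hM
    obtain ⟨π, hπ, he⟩ := (hpk k hk).1
    rw [hval π hπ] at he
    obtain ⟨i, hi, hci⟩ := aux_exists m hm π (hKsub π hπ).2 η hη1
      (fun i => hη.2 ⟨π, hπ, i, rfl⟩) c hcη
    refine ⟨i, hi, ?_⟩
    have := aux_upper m π (fun i => - q (k - ((i : ℕ) + 1))) M (hKsub π hπ).1 (hKsub π hπ).2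
      (fun i => by rw [abs_neg]; exact hM i) c i hci
    simp only [mul_neg, Finset.sum_neg_distrib, sub_neg_eq_add] at this
    rw [hq k, he]
    linarith
  have hB : ∀ (M : ℝ) (k : ℤ), 1 ≤ k → (∀ i : Fin m, |q (k - ((i : ℕ) + 1))| ≤ M) →
      ∀ i : Fin m, c * (M - q (k - ((i : ℕ) + 1))) ≤ M + q k := by
    intro M k hk hM i
    have hcomp : IsCompact ((fun π : Fin m → ℝ => π i) '' K) :=
      hKcpt.image (continuous_apply i)
    obtain ⟨y, hy⟩ := hcomp.exists_isGreatest (hKne.image _)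
    have hset : {y : ℝ | ∃ π ∈ K, y = π i} = (fun π : Fin m → ℝ => π i) '' K := by
      ext z; simp [eq_comm]
    have hνy : ν ≤ y := hν.2 ⟨i, by rw [hset]; exact hy⟩
    obtain ⟨π, hπ, hπy⟩ := hy.1
    have := aux_upper m π (fun i => q (k - ((i : ℕ) + 1))) M (hKsub π hπ).1 (hKsub π hπ).2
      hM c i (by simp only at hπy; linarith)
    have h2 := (hpk k hk).2 ⟨π, hπ, rfl⟩
    rw [hval π hπ] at h2
    rw [hq k]
    linarith
  have hc3 : 0 < c ^ 3 := by positivity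
  refine ⟨1 - c ^ 3, by nlinarith [mul_pos hc0 hc0], by linarith, ?_⟩
  intro k hk
  obtain ⟨M, hMdef⟩ : ∃ M, M = Dbar m p (k - 2 * m) := ⟨_, rfl⟩
  rw [← hMdef, ← hq]
  have hwin : ∀ i : ℕ, i < m → |q (k - 2 * m - i)| ≤ M := by
    intro i hi
    rw [hMdef, hq]
    refine le_csSup ?_ ⟨i, hi, rfl⟩
    refine Set.Finite.bddAbove ?_
    refine ((Finset.range m).finite_toSet.image
      (fun i : ℕ => |p (k - 2 * m - i) - 1 / 2|)).subset ?_
    rintro x ⟨i, hi, rfl⟩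
    exact ⟨i, by simpa using hi, rfl⟩
  have hM0 : 0 ≤ M := (abs_nonneg _).trans (hwin 0 (by omega))
  have hall : ∀ n : ℕ, |q (k - 3 * m + 1 + n)| ≤ M := by
    intro n
    induction n using Nat.strong_induction_on with
    | _ n ih =>
      by_cases hn : n < m
      · have := hwin (m - 1 - n) (by omega)
        rwa [show k - 2 * (m : ℤ) - ((m - 1 - n : ℕ) : ℤ) = k - 3 * m + 1 + n by omega] at this
      · have hpre : ∀ i : Fin m, |q (k - 3 * m + 1 + n - ((i : ℕ) + 1))| ≤ M := by
          intro i
          have hi := i.2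
          have := ih (n - 1 - i) (by omega)
          rwa [show k - 3 * (m : ℤ) + 1 + ((n - 1 - (i : ℕ) : ℕ) : ℤ)
            = k - 3 * m + 1 + n - ((i : ℕ) + 1) by omega] at this
        obtain ⟨i, -, h1⟩ := hA M _ (by omega) hpre
        have h2 := hB M _ (by omega) hpre i
        have h3 := abs_le.1 (hpre i)
        rw [abs_le]
        constructor <;> nlinarith
  have hge : ∀ l : ℤ, k - 3 * m + 1 ≤ l → |q l| ≤ M := by
    intro l hl
    have := hall (l - (k - 3 * m + 1)).toNat
    rwa [show k - 3 * (m : ℤ) + 1 + ((l - (k - 3 * m + 1)).toNat : ℤ) = l by omega] at this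
  have hneg : ∀ j : ℤ, k + 1 - m ≤ j → c ^ 2 * M ≤ M + q j := by
    intro j hj
    have hpj : ∀ i : Fin m, |q (j - ((i : ℕ) + 1))| ≤ M := fun i => hge _ (by have := i.2; omega)
    have hpj1 : ∀ i : Fin m, |q (j - 1 - ((i : ℕ) + 1))| ≤ M :=
      fun i => hge _ (by have := i.2; omega)
    have h1 := hB M j (by omega) hpj ⟨0, by omega⟩
    obtain ⟨i, hi, h2⟩ := hA M (j - 1) (by omega) hpj1
    have h3 := hB M j (by omega) hpj ⟨i + 1, hi⟩
    simp only [Nat.cast_zero, zero_add] at h1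
    rw [show j - (((((⟨i + 1, hi⟩ : Fin m) : ℕ)) : ℤ) + 1) = j - 1 - ((i : ℕ) + 1) by
      push_cast; ring] at h3
    have h4 : 0 ≤ M + q j := by linarith [(abs_le.1 (hge j (by omega))).1]
    have h5 := mul_le_mul_of_nonneg_left (add_le_add h2 h3) hc0.le
    have h6 : 2 * (c ^ 2 * M) ≤ (M + q j) * (1 + c) := by nlinarith
    nlinarith
  have hpk1 : ∀ i : Fin m, |q (k + 1 - ((i : ℕ) + 1))| ≤ M :=
    fun i => hge _ (by have := i.2; omega)
  obtain ⟨i, hi, h1⟩ := hA M (k + 1) (by omega) hpk1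
  have h2 := hneg (k + 1 - ((i : ℕ) + 1)) (by omega)
  have h3 := hneg (k + 1) (by omega)
  have h4 := mul_le_mul_of_nonneg_left h2 hc0.le
  have h5 : c ^ 3 * M ≤ c ^ 2 * M :=
    mul_le_mul_of_nonneg_right (pow_le_pow_of_le_one hc0.le (by linarith) (by norm_num)) hM0
  rw [abs_le]
  constructor <;> nlinarith
end

section
/- There exists a real number δ with 0 < δ < 1, depending only on m and K, such that for every integer k > 3m one has Δ̄_k ≤ δ · Δ̄_{k−3m}. -/
theorem wsum_le {m : ℕ} (w x : Fin m → ℝ) (hw : ∀ i, 0 ≤ w i) (hs : ∑ i, w i = 1)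
    (i : Fin m) (B y : ℝ) (hx : ∀ j, j ≠ i → x j ≤ B) (hy : x i ≤ y) :
    ∑ j, w j * x j ≤ B + w i * (y - B) := by
  have h1 : ∑ j, w j * x j ≤ ∑ j, (w j * B + if j = i then w j * (y - B) else 0) := by
    apply Finset.sum_le_sum
    intro j _
    by_cases h : j = i
    · subst h
      simp only [if_true]
      nlinarith [mul_le_mul_of_nonneg_left hy (hw j)]
    · simp only [h, if_false]
      nlinarith [mul_le_mul_of_nonneg_left (hx j h) (hw j)]
  rw [Finset.sum_add_distrib, ← Finset.sum_mul, hs, Finset.sum_ite_eq' Finset.univ i] at h1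
  simpa using h1

theorem contraction_core {m : ℕ} (hm : 1 < m) (K : Set (Fin m → ℝ))
    (hKsub : ∀ π ∈ K, (∀ i, 0 ≤ π i) ∧ ∑ i, π i = 1) (q : ℤ → ℝ)
    (hU : ∀ k : ℤ, 1 ≤ k → ∀ π ∈ K, -∑ i : Fin m, π i * q (k - ((i : ℕ) + 1)) ≤ q k)
    (hA : ∀ k : ℤ, 1 ≤ k → ∃ π ∈ K, q k = -∑ i : Fin m, π i * q (k - ((i : ℕ) + 1)))
    (η ν : ℝ) (hη : ∀ π ∈ K, ∀ i, π i ≤ η) (hη0 : 0 ≤ η) (hη1 : η < 1)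
    (hν : ∀ i : Fin m, ∃ π ∈ K, ν ≤ π i) (hν0 : 0 < ν) (hν1 : ν ≤ 1)
    (n : ℤ) (hn : 0 ≤ n) (D : ℝ) (hD : ∀ i : ℕ, i < m → |q (n - i)| ≤ D) :
    ∀ i : ℕ, i < m → |q (n + 3 * m - i)| ≤ (1 - (1 - η) * ν / 2) * D := by
  have i0 : Fin m := ⟨0, by omega⟩
  have hD0 : 0 ≤ D := (abs_nonneg _).trans (hD 0 (by omega))
  -- one-step bounds
  have up : ∀ (k : ℤ) (B : ℝ), 1 ≤ k → (∀ j : ℤ, k - m ≤ j → j < k → -B ≤ q j) → q k ≤ B := by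
    intro k B hk h
    obtain ⟨π, hπ, e⟩ := hA k hk
    have := wsum_le π (fun i => - q (k - ((i : ℕ) + 1))) (hKsub π hπ).1 (hKsub π hπ).2 i0 B B
      (fun j _ => by have := h (k - ((j : ℕ) + 1)) (by omega) (by omega); linarith)
      (by have := h (k - ((i0 : ℕ) + 1)) (by omega) (by omega); linarith)
    simp only [mul_neg, Finset.sum_neg_distrib] at this
    linarith
  have lo : ∀ (k : ℤ) (B : ℝ), 1 ≤ k → (∀ j : ℤ, k - m ≤ j → j < k → q j ≤ B) → -B ≤ q k := by
    intro k B hk h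
    obtain ⟨π, hπ, -⟩ := hA k hk
    have h2 := hU k hk π hπ
    have := wsum_le π (fun i => q (k - ((i : ℕ) + 1))) (hKsub π hπ).1 (hKsub π hπ).2 i0 B B
      (fun j _ => h (k - ((j : ℕ) + 1)) (by omega) (by omega))
      (h (k - ((i0 : ℕ) + 1)) (by omega) (by omega))
    linarith
  -- propagation
  have prop : ∀ (a : ℤ) (B : ℝ), 0 ≤ a → (∀ j : ℤ, a - m < j → j ≤ a → |q j| ≤ B) →
      ∀ j : ℤ, a - m < j → |q j| ≤ B := by
    intro a B ha h
    have key : ∀ N : ℕ, ∀ j : ℤ, a - m < j → j ≤ a + N → |q j| ≤ B := by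
      intro N
      induction N with
      | zero => intro j h1 h2; exact h j h1 (by simpa using h2)
      | succ N ih =>
        intro j h1 h2
        by_cases hj : j ≤ a + N
        · exact ih j h1 hj
        · push_cast at h2
          rw [abs_le]
          exact ⟨lo j B (by omega) fun l l1 l2 => (abs_le.1 (ih l (by omega) (by omega))).2,
            up j B (by omega) fun l l1 l2 => (abs_le.1 (ih l (by omega) (by omega))).1⟩
    intro j hj
    exact key (j - a).toNat j hj (by omega)
  have hall : ∀ j : ℤ, n - m < j → |q j| ≤ D := by
    apply prop n D hn
    intro j h1 h2
    have := hD (n - j).toNat (by omega)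
    rwa [show n - ((n - j).toNat : ℤ) = j by omega] at this
  set κ := (1 - η) * ν / 2 with hκ
  have hκ0 : 0 < κ := by have : 0 < 1 - η := by linarith
                         positivity
  have hκν : κ ≤ ν / 2 := by nlinarith
  have fin : ∀ a : ℤ, 0 ≤ a → a ≤ n + 3 * m → 
      (∀ j : ℤ, a - m < j → j ≤ a → |q j| ≤ (1 - κ) * D) →
      ∀ i : ℕ, i < m → |q (n + 3 * m - i)| ≤ (1 - κ) * D := by
    intro a ha ha2 h i hi
    exact prop a _ ha h _ (by omega)
  by_cases hc : ∃ t : ℤ, n + 1 ≤ t ∧ t ≤ n + 2 * m ∧ q t < -((1 - κ) * D)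
  · obtain ⟨t, ht1, ht2, hqt⟩ := hc
    have hqt0 : q t ≤ 0 := by
      have : 0 ≤ (1 - κ) * D := mul_nonneg (by linarith) hD0
      linarith
    have hlow : ∀ j : ℤ, t < j → j ≤ t + m → -((1 - ν) * D) ≤ q j := by
      intro j h1 h2
      have hi : (j - t - 1).toNat < m := by omega
      obtain ⟨π, hπ, hπi⟩ := hν ⟨_, hi⟩
      have h3 := hU j (by omega) π hπ
      have := wsum_le π (fun i => q (j - ((i : ℕ) + 1))) (hKsub π hπ).1 (hKsub π hπ).2 ⟨_, hi⟩ D 0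
        (fun l _ => (abs_le.1 (hall _ (by omega))).2)
        (by simp only; rwa [show j - (((j - t - 1).toNat : ℤ) + 1) = t by omega])
      nlinarith [mul_le_mul_of_nonneg_right hπi hD0]
    have hpre : ∀ j : ℤ, t - m ≤ j → j < t → 0 ≤ q j := by
      intro j h1 h2
      have hi : (t - j - 1).toNat < m := by omega
      obtain ⟨π, hπ, hπi⟩ := hν ⟨_, hi⟩
      have h3 := hU t (by omega) π hπ
      have := wsum_le π (fun i => q (t - ((i : ℕ) + 1))) (hKsub π hπ).1 (hKsub π hπ).2 ⟨_, hi⟩ D (q j)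
        (fun l _ => (abs_le.1 (hall _ (by omega))).2)
        (by simp only; rw [show t - (((t - j - 1).toNat : ℤ) + 1) = j by omega])
      have hqD := (abs_le.1 (hall j (by omega))).2
      by_contra hneg
      push Not at hneg
      nlinarith [mul_le_mul_of_nonneg_right hπi (sub_nonneg.2 hqD), mul_le_mul_of_nonneg_right hκν hD0]
    apply fin (t + m) (by omega) (by omega)
    intro j h1 h2
    have hi : (j - t - 1).toNat < m := by omega
    rw [abs_le]
    constructor
    · have := hlow j (by omega) h2
      nlinarith [mul_le_mul_of_nonneg_right hκν hD0]
    · obtain ⟨π, hπ, e⟩ := hA j (by omega)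
      have := wsum_le π (fun i => - q (j - ((i : ℕ) + 1))) (hKsub π hπ).1 (hKsub π hπ).2 ⟨_, hi⟩
        ((1 - ν) * D) D
        (fun l hl => by
          have hl' : (l : ℕ) ≠ (j - t - 1).toNat := fun h => hl (Fin.ext h)
          rcases lt_or_gt_of_ne hl' with h | h
          · have := hlow (j - ((l : ℕ) + 1)) (by omega) (by omega)
            linarith
          · have := hpre (j - ((l : ℕ) + 1)) (by omega) (by omega)
            have : 0 ≤ (1 - ν) * D := mul_nonneg (by linarith) hD0
            linarith)
        (by have := (abs_le.1 (hall (j - (((j - t - 1).toNat : ℤ) + 1)) (by omega))).1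
            simp only; linarith)
      simp only [mul_neg, Finset.sum_neg_distrib] at this
      have hb := hη π hπ ⟨_, hi⟩
      have hνD : 0 ≤ ν * D := by positivity
      have h5 := mul_le_mul_of_nonneg_right hb hνD
      have h6 : 0 ≤ (1 - η) * (ν * D) := mul_nonneg (by linarith) hνD
      rw [hκ]
      nlinarith
  · push Not at hc
    apply fin (n + 2 * m) (by omega) (by omega)
    have hu : ∀ j : ℤ, n + m < j → j ≤ n + 2 * m → q j ≤ (1 - κ) * D := by
      intro j h1 h2
      exact up j _ (by omega) fun l l1 l2 => hc l (by omega) (by omega)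
    intro j h1 h2
    rw [abs_le]
    exact ⟨hc j (by omega) h2, hu j (by omega) h2⟩

theorem stmt_11
    (m : ℕ) (hm : 1 < m)
    (K : Set (Fin m → ℝ)) (hKne : K.Nonempty) (hKcpt : IsCompact K)
    (hKsub : ∀ π ∈ K, (∀ i, 0 ≤ π i) ∧ ∑ i, π i = 1)
    (p : ℤ → ℝ)
    (hp0 : ∀ s : ℤ, s ≤ 0 → p s = 1)
    (hpk : ∀ k : ℤ, 1 ≤ k →
      IsGreatest {x : ℝ | ∃ π ∈ K, x = 1 - ∑ i : Fin m, π i * p (k - ((i : ℕ) + 1))} (p k))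
    (η : ℝ) (hη : IsGreatest {x : ℝ | ∃ π ∈ K, ∃ i : Fin m, x = π i} η) (hη1 : η < 1)
    (ν : ℝ)
    (hν : IsLeast {x : ℝ | ∃ i : Fin m, IsGreatest {y : ℝ | ∃ π ∈ K, y = π i} x} ν)
    (hν0 : 0 < ν) :
    ∃ δ : ℝ, 0 < δ ∧ δ < 1 ∧
      ∀ k : ℤ, 3 * (m : ℤ) < k →
        Dbar m p k ≤ δ * Dbar m p (k - 3 * m) := by
  have hq : ∀ (k : ℤ), ∀ π ∈ K, -∑ i : Fin m, π i * (p (k - ((i : ℕ) + 1)) - 1 / 2)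
      = (1 - ∑ i : Fin m, π i * p (k - ((i : ℕ) + 1))) - 1 / 2 := by
    intro k π hπ
    simp only [mul_sub, Finset.sum_sub_distrib, ← Finset.sum_mul, (hKsub π hπ).2]
    ring
  have hηle : ∀ π ∈ K, ∀ i, π i ≤ η := fun π hπ i => hη.2 ⟨π, hπ, i, rfl⟩
  have hν' : ∀ i : Fin m, ∃ π ∈ K, ν ≤ π i := by
    intro i
    obtain ⟨π, hπ, hmax⟩ := hKcpt.exists_isMaxOn hKne (continuous_apply i).continuousOn
    refine ⟨π, hπ, hν.2 ⟨i, ⟨π, hπ, rfl⟩, ?_⟩⟩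
    rintro y ⟨π', hπ', rfl⟩
    exact hmax hπ'
  have i0 : Fin m := ⟨0, by omega⟩
  obtain ⟨π0, hπ0, hνπ0⟩ := hν' i0
  have hνη : ν ≤ η := hνπ0.trans (hηle _ hπ0 _)
  refine ⟨1 - (1 - η) * ν / 2, by nlinarith, by nlinarith, ?_⟩
  intro k hk
  have hbdd : ∀ k, BddAbove {x : ℝ | ∃ i : ℕ, i < m ∧ x = |p (k - i) - 1/2|} := by
    intro k
    have : {x : ℝ | ∃ i : ℕ, i < m ∧ x = |p (k - i) - 1/2|}
        = (fun i : ℕ => |p (k - i) - 1/2|) '' Set.Iio m := by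
      ext x
      simp [eq_comm]
    rw [this]
    exact ((Set.finite_Iio m).image _).bddAbove
  have core := contraction_core hm K hKsub (fun k => p k - 1 / 2)
    (fun k hk π hπ => by
      have := (hpk k hk).2 ⟨π, hπ, rfl⟩
      rw [hq k π hπ]
      linarith)
    (fun k hk => by
      obtain ⟨π, hπ, e⟩ := (hpk k hk).1
      refine ⟨π, hπ, ?_⟩
      rw [hq k π hπ]
      linarith)
    η ν hηle (by linarith) hη1 hν' hν0 (by linarith) (k - 3 * m) (by omega)
    (Dbar m p (k - 3 * m))
    (fun i hi => le_csSup (hbdd _) ⟨i, hi, rfl⟩)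
  unfold Dbar at core ⊢
  refine csSup_le ⟨|p (k - (0 : ℕ)) - 1/2|, 0, by omega, rfl⟩ ?_
  rintro x ⟨i, hi, rfl⟩
  have := core i hi
  rwa [show k - 3 * (m : ℤ) + 3 * m - i = k - i by ring] at this
end

section
/- (Geometric decay) There exists a real number δ with 0 < δ < 1, depending only on m and K, such that for every integer N ≥ 0 one has Δ̄_{1+3mN} ≤ (1/2) · δ^N. Consequently Δ̄_k → 0 and Δ_k → 0 as k → ∞. -/
lemma Dbar_le_of (m : ℕ) (hm : 1 < m) (p : ℤ → ℝ) (k : ℤ) (D : ℝ)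
    (h : ∀ j : ℤ, k - m < j → |p j - 1/2| ≤ D) : Dbar m p k ≤ D := by
  unfold Dbar
  apply csSup_le
  · exact ⟨_, 0, by omega, rfl⟩
  · rintro x ⟨i, hi, rfl⟩
    exact h _ (by omega)

lemma Dbar_nonneg (m : ℕ) (p : ℤ → ℝ) (k : ℤ) : 0 ≤ Dbar m p k := by
  unfold Dbar
  apply Real.sSup_nonneg
  rintro x ⟨i, hi, rfl⟩
  exact abs_nonneg _

/-- One contraction step, for an abstract sequence. -/
lemma step_aux (m : ℕ) (hm : 1 < m) (K : Set (Fin m → ℝ))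
    (hKsub : ∀ π ∈ K, (∀ i, 0 ≤ π i) ∧ ∑ i, π i = 1)
    (d : ℤ → ℝ) (η ν : ℝ) (hη : ∀ π ∈ K, ∀ i, π i ≤ η) (hη1 : η < 1) (hν0 : 0 < ν) (hν1 : ν ≤ 1)
    (hν : ∀ i, ∃ π ∈ K, ν ≤ π i)
    (hlow : ∀ k : ℤ, 1 ≤ k → ∀ π ∈ K, - ∑ i : Fin m, π i * d (k - ((i : ℕ) + 1)) ≤ d k)
    (hup : ∀ k : ℤ, 1 ≤ k → ∃ π ∈ K, d k = - ∑ i : Fin m, π i * d (k - ((i : ℕ) + 1)))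
    (a : ℤ) (ha : 1 ≤ a + m) (D : ℝ) (hB : ∀ j, a ≤ j → |d j| ≤ D) :
    ∀ j, a + 3 * m ≤ j → |d j| ≤ (1 - (1 - η) * ν ^ 2) * D := by
  have hD : 0 ≤ D := (abs_nonneg _).trans (hB a le_rfl)
  have hB1 : ∀ j, a ≤ j → d j ≤ D := fun j hj => (abs_le.1 (hB j hj)).2
  have hB2 : ∀ j, a ≤ j → -D ≤ d j := fun j hj => (abs_le.1 (hB j hj)).1
  have star : ∀ j, a + m ≤ j → ∀ i : Fin m,
      -D + ν * (D - d (j - ((i : ℕ) + 1))) ≤ d j := by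
    intro j hj i
    obtain ⟨π, hπ, hi⟩ := hν i
    obtain ⟨h0, h1⟩ := hKsub π hπ
    have h := hlow j (by omega) π hπ
    have e : ∑ i : Fin m, π i * (D - d (j - ((i : ℕ) + 1)))
        = D - ∑ i : Fin m, π i * d (j - ((i : ℕ) + 1)) := by
      simp only [mul_sub, Finset.sum_sub_distrib, ← Finset.sum_mul, h1, one_mul]
    have nn : ∀ i : Fin m, 0 ≤ D - d (j - ((i : ℕ) + 1)) := fun i => by
      have := hB1 (j - ((i : ℕ) + 1)) (by have := i.2; omega)
      linarith
    have s := Finset.single_le_sum (f := fun i : Fin m => π i * (D - d (j - ((i : ℕ) + 1))))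
      (fun i _ => mul_nonneg (h0 i) (nn i)) (Finset.mem_univ i)
    have t := mul_le_mul_of_nonneg_right hi (nn i)
    linarith
  have pair : ∀ j j' : ℤ, a + m ≤ j' → j' < j → j ≤ j' + m →
      -D + ν * D ≤ d j ∨ -D + ν * D ≤ d j' := by
    intro j j' h1 h2 h3
    have h := star j (by omega) ⟨(j - j' - 1).toNat, by omega⟩
    have e : j - ((((⟨(j - j' - 1).toNat, by omega⟩ : Fin m) : ℕ) : ℤ) + 1) = j' := by
      simp only; omega
    rw [e] at h
    by_contra! hc
    have := hB2 j' (by omega)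
    nlinarith [hc.1, hc.2, mul_nonneg hν0.le hD]
  have upper : ∀ j, a + 2 * m ≤ j → d j ≤ D - (1 - η) * (ν * D) := by
    intro j hj
    obtain ⟨π, hπ, he⟩ := hup j (by omega)
    obtain ⟨h0, h1⟩ := hKsub π hπ
    have e : ∑ i : Fin m, π i * (D + d (j - ((i : ℕ) + 1)))
        = D + ∑ i : Fin m, π i * d (j - ((i : ℕ) + 1)) := by
      simp only [mul_add, Finset.sum_add_distrib, ← Finset.sum_mul, h1, one_mul]
    have key : ∃ b : Fin m, ∀ i, i ≠ b → ν * D ≤ D + d (j - ((i : ℕ) + 1)) := by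
      by_cases hx : ∃ b : Fin m, D + d (j - ((b : ℕ) + 1)) < ν * D
      · obtain ⟨b, hb⟩ := hx
        refine ⟨b, fun i hi => ?_⟩
        have hne : (i : ℕ) ≠ b := fun h => hi (Fin.ext h)
        have := i.2
        have := b.2
        rcases lt_or_gt_of_ne hne with h | h
        · rcases pair (j - ((i : ℕ) + 1)) (j - ((b : ℕ) + 1)) (by omega) (by omega) (by omega)
            with h | h <;> linarith
        · rcases pair (j - ((b : ℕ) + 1)) (j - ((i : ℕ) + 1)) (by omega) (by omega) (by omega)
            with h | h <;> linarith
      · push Not at hx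
        exact ⟨⟨0, by omega⟩, fun i _ => hx i⟩
    obtain ⟨b, hb⟩ := key
    have s : ∑ i : Fin m, π i * (if i = b then 0 else ν * D)
        ≤ ∑ i : Fin m, π i * (D + d (j - ((i : ℕ) + 1))) := by
      apply Finset.sum_le_sum
      intro i _
      apply mul_le_mul_of_nonneg_left _ (h0 i)
      split_ifs with h
      · have := hB2 (j - ((i : ℕ) + 1)) (by have := i.2; omega)
        linarith
      · exact hb i h
    have s2 : ∑ i : Fin m, π i * (if i = b then 0 else ν * D) = (1 - π b) * (ν * D) := by
      have : ∀ i, π i * (if i = b then 0 else ν * D)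
          = π i * (ν * D) - (if i = b then π i * (ν * D) else 0) := by
        intro i; split_ifs <;> ring
      simp only [this, Finset.sum_sub_distrib, ← Finset.sum_mul, h1, Finset.sum_ite_eq',
        Finset.mem_univ, if_true]
      ring
    have s3 : (1 - η) * (ν * D) ≤ (1 - π b) * (ν * D) :=
      mul_le_mul_of_nonneg_right (by linarith [hη π hπ b]) (by positivity)
    linarith
  intro j hj
  have q : 0 ≤ (1 - η) * (ν * D) := mul_nonneg (by linarith) (by positivity)
  rw [abs_le]
  constructor
  · have h := star j (by omega) ⟨0, by omega⟩
    have u := upper (j - 1) (by omega)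
    simp only [Nat.cast_zero, zero_add] at h
    nlinarith
  · have u := upper j (by omega)
    nlinarith

theorem stmt_12
    (m : ℕ) (hm : 1 < m)
    (K : Set (Fin m → ℝ)) (hKne : K.Nonempty) (hKcpt : IsCompact K)
    (hKsub : ∀ π ∈ K, (∀ i, 0 ≤ π i) ∧ ∑ i, π i = 1)
    (p : ℤ → ℝ)
    (hp0 : ∀ s : ℤ, s ≤ 0 → p s = 1)
    (hpk : ∀ k : ℤ, 1 ≤ k →
      IsGreatest {x : ℝ | ∃ π ∈ K, x = 1 - ∑ i : Fin m, π i * p (k - ((i : ℕ) + 1))} (p k))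
    (η : ℝ) (hη : IsGreatest {x : ℝ | ∃ π ∈ K, ∃ i : Fin m, x = π i} η) (hη1 : η < 1)
    (ν : ℝ)
    (hν : IsLeast {x : ℝ | ∃ i : Fin m, IsGreatest {y : ℝ | ∃ π ∈ K, y = π i} x} ν)
    (hν0 : 0 < ν) :
    (∃ δ : ℝ, 0 < δ ∧ δ < 1 ∧
      ∀ N : ℕ, Dbar m p (1 + 3 * m * N) ≤ 1/2 * δ ^ N) ∧
    Filter.Tendsto (fun k : ℕ => Dbar m p k) Filter.atTop (nhds 0) ∧
    Filter.Tendsto (fun k : ℕ => |p k - 1/2|) Filter.atTop (nhds 0) := by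
  have hm0 : 0 < m := by omega
  -- pointwise consequences of the extremal hypotheses
  have hη' : ∀ π ∈ K, ∀ i, π i ≤ η := fun π hπ i => hη.2 ⟨π, hπ, i, rfl⟩
  have hν' : ∀ i, ∃ π ∈ K, ν ≤ π i := by
    intro i
    obtain ⟨π, hπ, hmax⟩ := hKcpt.exists_isMaxOn hKne (continuous_apply i).continuousOn
    refine ⟨π, hπ, hν.2 ⟨i, ⟨π, hπ, rfl⟩, ?_⟩⟩
    rintro y ⟨π', hπ', rfl⟩
    exact hmax hπ'
  have hνη : ν ≤ η := by
    obtain ⟨π, hπ, h⟩ := hν' ⟨0, hm0⟩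
    exact h.trans (hη' π hπ _)
  have hsum : ∀ π ∈ K, ∀ k : ℤ, 1 - ∑ i : Fin m, π i * p (k - ((i : ℕ) + 1)) - 1/2
      = - ∑ i : Fin m, π i * (p (k - ((i : ℕ) + 1)) - 1/2) := by
    intro π hπ k
    simp only [mul_sub, Finset.sum_sub_distrib, ← Finset.sum_mul, (hKsub π hπ).2]
    ring
  have hlow : ∀ k : ℤ, 1 ≤ k → ∀ π ∈ K,
      - ∑ i : Fin m, π i * (p (k - ((i : ℕ) + 1)) - 1/2) ≤ p k - 1/2 := by
    intro k hk π hπ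
    rw [← hsum π hπ k]
    have := (hpk k hk).2 ⟨π, hπ, rfl⟩
    linarith
  have hup : ∀ k : ℤ, 1 ≤ k → ∃ π ∈ K,
      p k - 1/2 = - ∑ i : Fin m, π i * (p (k - ((i : ℕ) + 1)) - 1/2) := by
    intro k hk
    obtain ⟨π, hπ, h⟩ := (hpk k hk).1
    exact ⟨π, hπ, by rw [← hsum π hπ k, ← h]⟩
  have hbase : ∀ n : ℕ, ∀ j : ℤ, j ≤ n → |p j - 1/2| ≤ 1/2 := by
    intro n
    induction n with
    | zero => 
      intro j hj
      rw [hp0 j (by simpa using hj)]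
      norm_num
    | succ n ih =>
      intro j hj
      rcases le_or_gt j n with h | h
      · exact ih j h
      · obtain ⟨π, hπ, he⟩ := hup j (by omega)
        rw [he, abs_neg]
        calc |∑ i : Fin m, π i * (p (j - ((i : ℕ) + 1)) - 1/2)|
            ≤ ∑ i : Fin m, |π i * (p (j - ((i : ℕ) + 1)) - 1/2)| := Finset.abs_sum_le_sum_abs _ _
          _ ≤ ∑ i : Fin m, π i * (1/2) := by
              apply Finset.sum_le_sum
              intro i _
              rw [abs_mul, abs_of_nonneg ((hKsub π hπ).1 i)]
              apply mul_le_mul_of_nonneg_left _ ((hKsub π hπ).1 i)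
              exact ih _ (by push_cast at hj; omega)
          _ = 1/2 := by rw [← Finset.sum_mul, (hKsub π hπ).2, one_mul]
  set δ : ℝ := 1 - (1 - η) * ν ^ 2 with hδ
  have hδ0 : 0 < δ := by
    have h1 : ν ^ 2 ≤ 1 := by nlinarith
    have : (1 - η) * ν ^ 2 ≤ (1 - η) * 1 := mul_le_mul_of_nonneg_left h1 (by linarith)
    linarith
  have hδ1 : δ < 1 := by
    have : 0 < (1 - η) * ν ^ 2 := mul_pos (by linarith) (by positivity)
    linarith
  have main : ∀ N : ℕ, ∀ j : ℤ, 2 - (m : ℤ) + 3 * m * N ≤ j → |p j - 1/2| ≤ 1/2 * δ ^ N := by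
    intro N
    induction N with
    | zero =>
      intro j _
      simpa using hbase j.toNat j (by omega)
    | succ N ih =>
      intro j hj
      have hnn : (0 : ℤ) ≤ 3 * m * N := by positivity
      have := step_aux m hm K hKsub (fun j => p j - 1/2) η ν hη' hη1 hν0 (by linarith) hν' hlow hup
        (2 - (m : ℤ) + 3 * m * N) (by omega) _ ih j (by push_cast at hj; linarith)
      rw [pow_succ]
      linarith
  have hlim : Filter.Tendsto (fun N : ℕ => 1/2 * δ ^ N) Filter.atTop (nhds 0) := by
    simpa using (tendsto_pow_atTop_nhds_zero_of_lt_one hδ0.le hδ1).const_mul (1/2 : ℝ)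
  have hDlim : Filter.Tendsto (fun k : ℕ => Dbar m p k) Filter.atTop (nhds 0) := by
    rw [Metric.tendsto_atTop]
    intro ε hε
    obtain ⟨N, hN⟩ := (hlim.eventually (gt_mem_nhds hε)).exists
    refine ⟨1 + 3 * m * N, fun k hk => ?_⟩
    rw [Real.dist_eq, sub_zero, abs_of_nonneg (Dbar_nonneg _ _ _)]
    refine lt_of_le_of_lt (Dbar_le_of m hm p k _ fun j hj => main N j ?_) hN
    have : (1 : ℤ) + 3 * m * N ≤ k := by exact_mod_cast hk
    linarith [Int.add_one_le_iff.2 hj]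
  refine ⟨⟨δ, hδ0, hδ1, fun N => Dbar_le_of m hm p _ _ fun j hj => main N j ?_⟩, hDlim, ?_⟩
  · linarith [Int.add_one_le_iff.2 hj]
  · refine squeeze_zero (fun _ => abs_nonneg _) (fun k => ?_) hDlim
    unfold Dbar
    apply le_csSup
    · refine ⟨1/2, ?_⟩
      rintro x ⟨i, hi, rfl⟩
      exact hbase ((k : ℤ) - i).toNat _ (by omega)
    · exact ⟨0, hm0, by simp⟩
end

section
/- Assume that for some integer k > 2m one has p_{k+1} ≥ 1/2. Then for the constant δ ∈ (0,1) of the drop-down lemma (depending only on m and K), Δ̄⁻_k ≤ δ · Δ̄_{k−2m}, where Δ⁻_j = max{0, 1/2 − p_j} and Δ̄⁻_k = max_{i∈W_k} Δ⁻_i. More precisely: there exists δ ∈ (0,1) depending only on m and K such that for all k > 2m, Δ̄⁻_k ≤ δ · Δ̄_{k−2m}. -/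
theorem stmt_15
    (m : ℕ) (hm : 1 < m)
    (K : Set (Fin m → ℝ)) (hKne : K.Nonempty) (hKcpt : IsCompact K)
    (hKsub : ∀ π ∈ K, (∀ i, 0 ≤ π i) ∧ ∑ i, π i = 1)
    (p : ℤ → ℝ)
    (hp0 : ∀ s : ℤ, s ≤ 0 → p s = 1)
    (hpk : ∀ k : ℤ, 1 ≤ k →
      IsGreatest {x : ℝ | ∃ π ∈ K, x = 1 - ∑ i : Fin m, π i * p (k - ((i : ℕ) + 1))} (p k))
    (η : ℝ) (hη : IsGreatest {x : ℝ | ∃ π ∈ K, ∃ i : Fin m, x = π i} η) (hη1 : η < 1)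
    (ν : ℝ)
    (hν : IsLeast {x : ℝ | ∃ i : Fin m, IsGreatest {y : ℝ | ∃ π ∈ K, y = π i} x} ν)
    (hν0 : 0 < ν) :
    ∃ δ : ℝ, 0 < δ ∧ δ < 1 ∧
      ∀ k : ℤ, 2 * (m : ℤ) < k →
        DbarNeg m p k ≤ δ * Dbar m p (k - 2 * m) := by
  have hsum : ∀ π ∈ K, ∀ j : ℤ, 1 - ∑ i : Fin m, π i * p (j - ((i : ℕ) + 1)) - 1/2
      = - ∑ i : Fin m, π i * (p (j - ((i : ℕ) + 1)) - 1/2) := by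
    intro π hπ j
    have h := (hKsub π hπ).2
    simp only [mul_sub, Finset.sum_sub_distrib, ← Finset.sum_mul, h]
    ring
  obtain ⟨q, hq⟩ : ∃ q : ℤ → ℝ, ∀ j, q j = p j - 1/2 := ⟨fun j => p j - 1/2, fun _ => rfl⟩
  have h1 : ∀ j : ℤ, 1 ≤ j → ∀ π ∈ K, - ∑ i : Fin m, π i * q (j - ((i : ℕ) + 1)) ≤ q j := by
    intro j hj π hπ
    simp only [hq]
    rw [← hsum π hπ j]
    have := (hpk j hj).2 ⟨π, hπ, rfl⟩
    linarith
  have h2 : ∀ j : ℤ, 1 ≤ j → ∃ π ∈ K, q j = - ∑ i : Fin m, π i * q (j - ((i : ℕ) + 1)) := by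
    intro j hj
    obtain ⟨π, hπ, h⟩ := (hpk j hj).1
    refine ⟨π, hπ, ?_⟩
    simp only [hq]
    rw [← hsum π hπ j, h]
  have hηb : ∀ π ∈ K, ∀ i, π i ≤ η := fun π hπ i => hη.2 ⟨π, hπ, i, rfl⟩
  have hνb : ∀ i : Fin m, ∃ π ∈ K, ν ≤ π i := by
    intro i
    obtain ⟨π, hπ, hmax⟩ := hKcpt.exists_isMaxOn hKne (continuous_apply i).continuousOn
    refine ⟨π, hπ, hν.2 ⟨i, ⟨π, hπ, rfl⟩, ?_⟩⟩
    rintro y ⟨ρ, hρ, rfl⟩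
    exact hmax hρ
  have hνη : ν ≤ η := by
    obtain ⟨π, hπ, h⟩ := hνb ⟨0, by omega⟩
    exact h.trans (hηb π hπ _)
  have hprod : 0 < ν * (1 - η) := mul_pos hν0 (by linarith)
  refine ⟨1 - ν * (1 - η), by nlinarith, by linarith, ?_⟩
  intro k hk
  obtain ⟨D, hD⟩ : ∃ D, D = Dbar m p (k - 2 * m) := ⟨_, rfl⟩
  rw [← hD]
  have hwin : ∀ i : ℕ, i < m → |q (k - 2 * m - i)| ≤ D := by
    intro i hi
    rw [hD, hq]
    refine le_csSup ?_ ⟨i, hi, rfl⟩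
    have : {x : ℝ | ∃ i : ℕ, i < m ∧ x = |p (k - 2 * m - i) - 1/2|}
        = Set.image (fun i : ℕ => |p (k - 2 * m - i) - 1/2|) (Set.Iio m) := by
      ext x
      simp only [Set.mem_ofPred_eq, Set.mem_image, Set.mem_Iio]
      exact ⟨fun ⟨i, h, e⟩ => ⟨i, h, e.symm⟩, fun ⟨i, h, e⟩ => ⟨i, h, e.symm⟩⟩
    rw [this]
    exact ((Set.finite_Iio m).image _).bddAbove
  have hD0 : 0 ≤ D := (abs_nonneg _).trans (hwin 0 (by omega))
  have hall : ∀ t : ℕ, |q (k - 3 * m + 1 + t)| ≤ D := by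
    intro t
    induction t using Nat.strong_induction_on with
    | _ t ih =>
      by_cases ht : t < m
      · have := hwin (m - 1 - t) (by omega)
        have e : (k - 2 * m - ((m - 1 - t : ℕ) : ℤ)) = k - 3 * m + 1 + t := by omega
        rwa [e] at this
      · obtain ⟨π, hπ, h⟩ := h2 (k - 3 * m + 1 + t) (by omega)
        obtain ⟨hp, hs⟩ := hKsub π hπ
        rw [h, abs_neg]
        calc _ ≤ ∑ i : Fin m, |π i * q (k - 3 * m + 1 + t - ((i : ℕ) + 1))| :=
              Finset.abs_sum_le_sum_abs _ _
          _ ≤ ∑ i : Fin m, π i * D := by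
              refine Finset.sum_le_sum fun i _ => ?_
              rw [abs_mul, abs_of_nonneg (hp i)]
              refine mul_le_mul_of_nonneg_left ?_ (hp i)
              have hi := i.2
              have := ih (t - (i + 1)) (by omega)
              have e : k - 3 * m + 1 + ((t - (i + 1) : ℕ) : ℤ)
                  = k - 3 * m + 1 + t - ((i : ℕ) + 1) := by omega
              rwa [e] at this
          _ = D := by rw [← Finset.sum_mul, hs, one_mul]
  have hbd : ∀ j : ℤ, k - 3 * m + 1 ≤ j → |q j| ≤ D := by
    intro j hj
    have := hall (j - (k - 3 * m + 1)).toNat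
    have e : k - 3 * m + 1 + (((j - (k - 3 * m + 1)).toNat : ℕ) : ℤ) = j := by omega
    rwa [e] at this
  refine csSup_le ⟨_, 0, by omega, rfl⟩ ?_
  rintro x ⟨a, ha, rfl⟩
  have hδ0 : 0 ≤ 1 - ν * (1 - η) := by nlinarith
  refine max_le (mul_nonneg hδ0 hD0) ?_
  obtain ⟨j, hj⟩ : ∃ j : ℤ, j = k - a := ⟨_, rfl⟩
  rw [← hj]
  by_contra hcon
  push Not at hcon
  have hqj : q j < - ((1 - ν * (1 - η)) * D) := by rw [hq]; linarith
  have hDpos : 0 < D := by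
    rcases hD0.lt_or_eq with h | h
    · exact h
    · have := abs_le.1 (hbd j (by omega))
      rw [← h] at this hqj
      linarith [this.1]
  -- all previous entries are close to D
  have hclose : ∀ i : Fin m, η * D < q (j - ((i : ℕ) + 1)) := by
    intro i
    obtain ⟨π, hπ, hπi⟩ := hνb i
    obtain ⟨hp, hs⟩ := hKsub π hπ
    have h := h1 j (by omega) π hπ
    have hgap : π i * (D - q (j - ((i : ℕ) + 1)))
        ≤ ∑ l : Fin m, π l * (D - q (j - ((l : ℕ) + 1))) := by
      refine Finset.single_le_sum (f := fun l : Fin m => π l * (D - q (j - ((l : ℕ) + 1))))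
        (fun l _ => ?_) (Finset.mem_univ i)
      have hl := l.2
      exact mul_nonneg (hp l) (by linarith [(abs_le.1 (hbd (j - ((l : ℕ) + 1)) (by omega))).2])
    have e : ∑ l : Fin m, π l * (D - q (j - ((l : ℕ) + 1)))
        = D - ∑ l : Fin m, π l * q (j - ((l : ℕ) + 1)) := by
      simp only [mul_sub, Finset.sum_sub_distrib, ← Finset.sum_mul, hs, one_mul]
    rw [e] at hgap
    have hi := i.2
    have hnn : 0 ≤ D - q (j - ((i : ℕ) + 1)) := by
      linarith [(abs_le.1 (hbd (j - ((i : ℕ) + 1)) (by omega))).2]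
    have h3 : ν * (D - q (j - ((i : ℕ) + 1))) ≤ π i * (D - q (j - ((i : ℕ) + 1))) :=
      mul_le_mul_of_nonneg_right hπi hnn
    have h4 : ν * (D - q (j - ((i : ℕ) + 1))) < ν * ((1 - η) * D) := by nlinarith
    have h5 := lt_of_mul_lt_mul_left h4 hν0.le
    linarith
  obtain ⟨π, hπ, h⟩ := h2 (j - 1) (by omega)
  obtain ⟨hp, hs⟩ := hKsub π hπ
  have hc1 := hclose ⟨0, by omega⟩
  simp only [Nat.cast_zero, zero_add] at hc1
  let z : Fin m := ⟨m - 1, by omega⟩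
  have hlow : ∑ i : Fin m, π i * (if i = z then -D else η * D)
      ≤ ∑ i : Fin m, π i * q (j - 1 - ((i : ℕ) + 1)) := by
    refine Finset.sum_le_sum fun i _ => mul_le_mul_of_nonneg_left ?_ (hp i)
    have hi := i.2
    split_ifs with hz
    · exact (abs_le.1 (hbd _ (by omega))).1
    · have hne : (i : ℕ) ≠ m - 1 := fun h => hz (Fin.ext h)
      have := hclose ⟨i + 1, by omega⟩
      have e : j - (((i + 1 : ℕ) : ℤ) + 1) = j - 1 - ((i : ℕ) + 1) := by push_cast; ring
      simp only [e] at this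
      exact this.le
  have e : ∑ i : Fin m, π i * (if i = z then -D else η * D)
      = η * D - π z * ((1 + η) * D) := by
    have : ∀ i : Fin m, π i * (if i = z then -D else η * D)
        = π i * (η * D) - (if i = z then π i * ((1 + η) * D) else 0) := by
      intro i
      split_ifs <;> ring
    simp only [this, Finset.sum_sub_distrib, ← Finset.sum_mul, hs, one_mul]
    simp
  rw [e] at hlow
  have hz := hηb π hπ z
  have h6 : π z * ((1 + η) * D) ≤ η * ((1 + η) * D) :=
    mul_le_mul_of_nonneg_right hz (mul_nonneg (by linarith) hD0)
  have h7 : η * (η * D) < η * D := by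
    have : η * D < D := by nlinarith
    exact mul_lt_mul_of_pos_left this (by linarith)
  nlinarith
end
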